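/- Let B be an open ball of ℝ^d centered at the origin. For every nonnegative continuous function f on ∂B, there exists one and only one nonnegative h ∈ C(closure of B) such that h = f on ∂B and h is Δ_k-harmonic in B in the distributional sense. -/

import Mathlib

open MeasureTheory Real Filter
open scoped RealInnerProductSpace ENNReal Topology

noncomputable section

abbrev E (d : ℕ) := EuclideanSpace ℝ (Fin d)

/-- The reflection σ_α in the hyperplane orthogonal to α. -/
def dunklReflect {d : ℕ} (α x : E d) : E d := x - ((2 * ⟪α, x⟫) / ‖α‖ ^ 2) • α

/-- The Euclidean Laplacian, as the trace of the second derivative. -/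
def lap {d : ℕ} (u : E d → ℝ) (x : E d) : ℝ :=
  ∑ i : Fin d, iteratedFDeriv ℝ 2 u x ![EuclideanSpace.single i 1, EuclideanSpace.single i 1]

/-- The Dunkl Laplacian Δ_k associated with the root system `R` and multiplicity `k`. -/
def dunklLap {d : ℕ} (R : Finset (E d)) (k : E d → ℝ) (u : E d → ℝ) (x : E d) : ℝ :=
  lap u x + ∑ α ∈ R, k α * (⟪gradient u x, α⟫ / ⟪α, x⟫ -
    (‖α‖ ^ 2 / 2) * ((u x - u (dunklReflect α x)) / ⟪α, x⟫ ^ 2))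

/-- The weight function w_k. -/
def wk {d : ℕ} (R : Finset (E d)) (k : E d → ℝ) (x : E d) : ℝ :=
  ∏ α ∈ R, |⟪x, α⟫| ^ (k α)

/-- `h` is Δ_k-harmonic on `D` in the distributional sense. -/
def IsDunklHarmonic {d : ℕ} (R : Finset (E d)) (k : E d → ℝ) (D : Set (E d))
    (h : E d → ℝ) : Prop :=
  ∀ ψ : E d → ℝ, ContDiff ℝ (⊤ : ℕ∞) ψ → HasCompactSupport ψ → tsupport ψ ⊆ D →
    ∫ x in D, h x * dunklLap R k ψ x * wk R k x = 0

section Reflection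

variable {d : ℕ}

theorem dunklReflect_eq_reflection (α x : E d) :
    dunklReflect α x = (ℝ ∙ α)ᗮ.reflection x := by
  rw [Submodule.reflection_orthogonal_apply, Submodule.reflection_singleton_apply]
  simp only [dunklReflect, RCLike.ofReal_real_eq_id, id, two_smul, neg_sub, ← add_smul]
  congr 2
  ring

theorem norm_dunklReflect (α x : E d) : ‖dunklReflect α x‖ = ‖x‖ := by
  rw [dunklReflect_eq_reflection, LinearIsometryEquiv.norm_map]

theorem dunklReflect_dunklReflect (α x : E d) : dunklReflect α (dunklReflect α x) = x := by
  simp only [dunklReflect_eq_reflection, Submodule.reflection_reflection]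

theorem inner_dunklReflect_dunklReflect (α x y : E d) :
    ⟪dunklReflect α x, dunklReflect α y⟫ = ⟪x, y⟫ := by
  simp only [dunklReflect_eq_reflection, LinearIsometryEquiv.inner_map_map]

theorem inner_dunklReflect_right (α x y : E d) :
    ⟪x, dunklReflect α y⟫ = ⟪dunklReflect α x, y⟫ := by
  rw [← inner_dunklReflect_dunklReflect α x, dunklReflect_dunklReflect]

theorem dunklReflect_self (α : E d) : dunklReflect α α = -α := by
  rw [dunklReflect_eq_reflection, Submodule.reflection_orthogonalComplement_singleton_eq_neg]

theorem inner_self_dunklReflect (α x : E d) : ⟪α, dunklReflect α x⟫ = -⟪α, x⟫ := by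
  rw [inner_dunklReflect_right, dunklReflect_self, inner_neg_left]

theorem contDiff_dunklReflect (α : E d) {n : WithTop ℕ∞} : ContDiff ℝ n (dunklReflect α) := by
  have : dunklReflect α = (ℝ ∙ α)ᗮ.reflection := funext (dunklReflect_eq_reflection α)
  rw [this]
  exact ((ℝ ∙ α)ᗮ.reflection : E d ≃ₗᵢ[ℝ] E d).contDiff

theorem continuous_dunklReflect (α : E d) : Continuous (dunklReflect α) :=
  (contDiff_dunklReflect α (n := 0)).continuous

theorem integral_comp_dunklReflect (α : E d) (g : E d → ℝ) :
    ∫ x, g (dunklReflect α x) = ∫ x, g x := by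
  have h := ((ℝ ∙ α)ᗮ.reflection : E d ≃ₗᵢ[ℝ] E d).measurePreserving
  simp only [dunklReflect_eq_reflection]
  exact h.integral_comp (Homeomorph.measurableEmbedding
    ((ℝ ∙ α)ᗮ.reflection : E d ≃ₗᵢ[ℝ] E d).toHomeomorph) g

/-- The complement of the reflecting hyperplanes. -/
def regularSet (R : Finset (E d)) : Set (E d) := {x | ∀ α ∈ R, ⟪α, x⟫ ≠ 0}

theorem ae_mem_regularSet {R : Finset (E d)} (hR0 : ∀ α ∈ R, α ≠ 0) :
    ∀ᵐ x : E d, x ∈ regularSet R := by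
  have h : ∀ α ∈ R, ∀ᵐ x : E d, ⟪α, x⟫ ≠ 0 := by
    intro α hα
    have h0 := Measure.addHaar_submodule (volume : Measure (E d))
      (LinearMap.ker (innerₛₗ ℝ α)) (by
        intro h
        rw [LinearMap.ker_eq_top] at h
        have := congrArg (fun l => l α) h
        simp [hR0 α hα] at this)
    rw [ae_iff]
    convert h0 using 2
    ext x
    simp
  exact (ae_ball_iff R.countable_toSet).2 h

theorem dense_regularSet {R : Finset (E d)} (hR0 : ∀ α ∈ R, α ≠ 0) : Dense (regularSet R) :=
  Measure.dense_of_ae (ae_mem_regularSet hR0)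

end Reflection

section Calculus

variable {d : ℕ}

/-- The second derivative of `u` at `x` in the direction `v`. -/
def secondDeriv (u : E d → ℝ) (x v : E d) : ℝ := fderiv ℝ (fderiv ℝ u) x v v

theorem lap_eq_sum (u : E d → ℝ) (x : E d) :
    lap u x = ∑ i : Fin d, secondDeriv u x (EuclideanSpace.single i 1) := by
  simp [lap, secondDeriv, iteratedFDeriv_two_apply]

theorem dunklLap_eq (R : Finset (E d)) (k : E d → ℝ) (u : E d → ℝ) (x : E d) :
    dunklLap R k u x = lap u x + ∑ α ∈ R, k α * (fderiv ℝ u x α / ⟪α, x⟫ -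
      (‖α‖ ^ 2 / 2) * ((u x - u (dunklReflect α x)) / ⟪α, x⟫ ^ 2)) := by
  simp only [dunklLap, inner_gradient_left]

theorem continuous_fderiv_const {u : E d → ℝ} (hu : ContDiff ℝ 2 u) (v : E d) :
    Continuous fun x => fderiv ℝ u x v :=
  (hu.continuous_fderiv (by norm_num)).clm_apply continuous_const

theorem contDiff_fderiv_const {u : E d → ℝ} (hu : ContDiff ℝ 2 u) (v : E d) :
    ContDiff ℝ 1 fun x => fderiv ℝ u x v :=
  (hu.fderiv_right (m := 1) (by norm_num)).clm_apply contDiff_const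

theorem continuous_secondDeriv {u : E d → ℝ} (hu : ContDiff ℝ 2 u) (v : E d) :
    Continuous fun x => secondDeriv u x v :=
  (((hu.fderiv_right (m := 1) (by norm_num)).continuous_fderiv (by norm_num)).clm_apply
    continuous_const).clm_apply continuous_const

theorem hasFDerivAt_fderiv_const {u : E d → ℝ} (hu : ContDiff ℝ 2 u) (x v : E d) :
    HasFDerivAt (fun y => fderiv ℝ u y v) ((fderiv ℝ (fderiv ℝ u) x).flip v) x := by
  have h := ((hu.fderiv_right (m := 1) (by norm_num)).differentiable (by norm_num) x).hasFDerivAt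
  simpa using h.clm_apply (hasFDerivAt_const v x)

theorem fderiv_fderiv_const {u : E d → ℝ} (hu : ContDiff ℝ 2 u) (x v : E d) :
    fderiv ℝ (fun y => fderiv ℝ u y v) x v = secondDeriv u x v := by
  rw [(hasFDerivAt_fderiv_const hu x v).fderiv]
  rfl

theorem continuous_lap {u : E d → ℝ} (hu : ContDiff ℝ 2 u) : Continuous (lap u) := by
  simp only [funext (lap_eq_sum u)]
  exact continuous_finsetSum _ fun i _ => continuous_secondDeriv hu _

theorem hasDerivAt_line {u : E d → ℝ} (hu : ContDiff ℝ 2 u) (x v : E d) (s : ℝ) :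
    HasDerivAt (fun s : ℝ => u (x + s • v)) (fderiv ℝ u (x + s • v) v) s := by
  have h1 : HasDerivAt (fun s : ℝ => x + s • v) v s := by
    simpa using ((hasDerivAt_id s).smul_const v).const_add x
  exact ((hu.differentiable (by norm_num) _).hasFDerivAt).comp_hasDerivAt s h1

theorem hasDerivAt_line_fderiv {u : E d → ℝ} (hu : ContDiff ℝ 2 u) (x v : E d) (s : ℝ) :
    HasDerivAt (fun s : ℝ => fderiv ℝ u (x + s • v) v) (secondDeriv u (x + s • v) v) s := by
  have h1 : HasDerivAt (fun s : ℝ => x + s • v) v s := by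
    simpa using ((hasDerivAt_id s).smul_const v).const_add x
  exact (hasFDerivAt_fderiv_const hu (x + s • v) v).comp_hasDerivAt s h1

theorem secondDeriv_smul (u : E d → ℝ) (x v : E d) (c : ℝ) :
    secondDeriv u x (c • v) = c ^ 2 * secondDeriv u x v := by
  simp only [secondDeriv, map_smul, smul_apply, smul_eq_mul]
  ring

/-- The contribution of the root `α` to the Dunkl Laplacian, extended continuously across the
hyperplane orthogonal to `α`. -/
def rootTerm (α : E d) (u : E d → ℝ) (x : E d) : ℝ :=
  2 / ‖α‖ ^ 2 * ∫ s in (0 : ℝ)..1,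
    (1 - s) * secondDeriv u (x + s • (-(2 * ⟪α, x⟫ / ‖α‖ ^ 2) • α)) α

theorem sq_mul_rootTerm {α : E d} (hα : α ≠ 0) {u : E d → ℝ} (hu : ContDiff ℝ 2 u) (x : E d) :
    ⟪α, x⟫ ^ 2 * rootTerm α u x =
      ⟪α, x⟫ * fderiv ℝ u x α - ‖α‖ ^ 2 / 2 * (u x - u (dunklReflect α x)) := by
  set c : ℝ := -(2 * ⟪α, x⟫ / ‖α‖ ^ 2) with hc
  have hn : ‖α‖ ≠ 0 := norm_ne_zero_iff.2 hα
  have hcont : Continuous fun s : ℝ => (1 - s) * secondDeriv u (x + s • (c • α)) (c • α) :=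
    (continuous_const.sub continuous_id).mul
      ((continuous_secondDeriv hu (c • α)).comp (by fun_prop))
  have h := intervalIntegral.integral_eq_sub_of_hasDerivAt (a := 0) (b := 1)
    (f := fun s : ℝ => (1 - s) * fderiv ℝ u (x + s • (c • α)) (c • α) + u (x + s • (c • α)))
    (f' := fun s : ℝ => (1 - s) * secondDeriv u (x + s • (c • α)) (c • α))
    (fun s _ => by
      have h1 := (((hasDerivAt_id s).const_sub 1).mul
        (hasDerivAt_line_fderiv hu x (c • α) s)).add (hasDerivAt_line hu x (c • α) s)
      refine h1.congr_deriv ?_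
      simp) (hcont.intervalIntegrable _ _)
  have hs : x + c • α = dunklReflect α x := by
    rw [hc, dunklReflect, neg_smul, sub_eq_add_neg]
  simp only [secondDeriv_smul, mul_left_comm _ (c ^ 2), intervalIntegral.integral_const_mul,
    one_smul, zero_smul, add_zero, sub_self, zero_mul, zero_add, sub_zero, one_mul, hs,
    map_smul, smul_eq_mul] at h
  rw [rootTerm, ← hc]
  have hc2 : c * ‖α‖ ^ 2 = -(2 * ⟪α, x⟫) := by rw [hc]; field_simp
  generalize (∫ s in (0 : ℝ)..1, (1 - s) * secondDeriv u (x + s • (c • α)) α) = I at h ⊢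
  have ht : ⟪α, x⟫ = -(c * ‖α‖ ^ 2) / 2 := by linarith
  rw [ht]
  field_simp
  linear_combination h

theorem rootTerm_of_inner_eq_zero {α x : E d} (u : E d → ℝ) (hx : ⟪α, x⟫ = 0) :
    rootTerm α u x = secondDeriv u x α / ‖α‖ ^ 2 := by
  have h : (∫ s in (0 : ℝ)..1, (1 - s)) = 1 / 2 := by
    rw [intervalIntegral.integral_sub (by simp) (by simp)]
    simp
    norm_num
  simp only [rootTerm, hx, mul_zero, zero_div, neg_zero, zero_smul, smul_zero, add_zero,
    intervalIntegral.integral_mul_const, h]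
  ring

theorem continuous_rootTerm (α : E d) {u : E d → ℝ} (hu : ContDiff ℝ 2 u) :
    Continuous (rootTerm α u) := by
  refine continuous_const.mul
    (intervalIntegral.continuous_parametric_intervalIntegral_of_continuous' ?_ 0 1)
  refine Continuous.mul (by fun_prop) ((continuous_secondDeriv hu α).comp ?_)
  have : Continuous fun p : E d × ℝ => ⟪α, p.1⟫ := continuous_const.inner continuous_fst
  fun_prop

/-- The continuous extension of the Dunkl Laplacian of a `C²` function to the whole space. -/
def contDunklLap (R : Finset (E d)) (k : E d → ℝ) (u : E d → ℝ) (x : E d) : ℝ :=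
  lap u x + ∑ α ∈ R, k α * rootTerm α u x

theorem continuous_contDunklLap (R : Finset (E d)) (k : E d → ℝ) {u : E d → ℝ}
    (hu : ContDiff ℝ 2 u) : Continuous (contDunklLap R k u) :=
  (continuous_lap hu).add (continuous_finsetSum _ fun α _ =>
    continuous_const.mul (continuous_rootTerm α hu))

theorem contDunklLap_eq_dunklLap {R : Finset (E d)} (hR0 : ∀ α ∈ R, α ≠ 0) (k : E d → ℝ)
    {u : E d → ℝ} (hu : ContDiff ℝ 2 u) {x : E d} (hx : x ∈ regularSet R) :
    contDunklLap R k u x = dunklLap R k u x := by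
  rw [contDunklLap, dunklLap_eq]
  congr 1
  refine Finset.sum_congr rfl fun α hα => ?_
  have h := sq_mul_rootTerm (hR0 α hα) hu x
  have ht := hx α hα
  congr 1
  field_simp
  linear_combination 2 * h

end Calculus

section Algebra

variable {d : ℕ}

theorem secondDeriv_add {u v : E d → ℝ} (hu : ContDiff ℝ 2 u) (hv : ContDiff ℝ 2 v) (x a : E d) :
    secondDeriv (fun y => u y + v y) x a = secondDeriv u x a + secondDeriv v x a := by
  rw [← fderiv_fderiv_const (hu.add hv), ← fderiv_fderiv_const hu, ← fderiv_fderiv_const hv]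
  have h : (fun y => fderiv ℝ (fun y => u y + v y) y a) =
      fun y => fderiv ℝ u y a + fderiv ℝ v y a := by
    funext y
    rw [fderiv_fun_add (hu.differentiable (by norm_num) y) (hv.differentiable (by norm_num) y)]
    rfl
  rw [h, fderiv_fun_add ((contDiff_fderiv_const hu a).differentiable (by norm_num) x)
    ((contDiff_fderiv_const hv a).differentiable (by norm_num) x)]
  rfl

theorem secondDeriv_mul {u v : E d → ℝ} (hu : ContDiff ℝ 2 u) (hv : ContDiff ℝ 2 v) (x a : E d) :
    secondDeriv (fun y => u y * v y) x a =
      u x * secondDeriv v x a + v x * secondDeriv u x a + 2 * (fderiv ℝ u x a * fderiv ℝ v x a) := by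
  rw [← fderiv_fderiv_const (hu.mul hv), ← fderiv_fderiv_const hu, ← fderiv_fderiv_const hv]
  have hu1 : Differentiable ℝ u := hu.differentiable (by norm_num)
  have hv1 : Differentiable ℝ v := hv.differentiable (by norm_num)
  have hu2 := (contDiff_fderiv_const hu a).differentiable (by norm_num)
  have hv2 := (contDiff_fderiv_const hv a).differentiable (by norm_num)
  have h : (fun y => fderiv ℝ (fun y => u y * v y) y a) =
      fun y => u y * fderiv ℝ v y a + v y * fderiv ℝ u y a := by
    funext y
    rw [fderiv_fun_mul (hu1 y) (hv1 y)]
    rfl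
  rw [h, fderiv_fun_add ((hu1 x).fun_mul (hv2 x)) ((hv1 x).fun_mul (hu2 x)),
    fderiv_fun_mul (hu1 x) (hv2 x), fderiv_fun_mul (hv1 x) (hu2 x)]
  simp only [add_apply, smul_apply, smul_eq_mul]
  ring

theorem secondDeriv_const (c : ℝ) (x a : E d) : secondDeriv (fun _ => c) x a = 0 := by
  simp [secondDeriv]

theorem dunklLap_const (R : Finset (E d)) (k : E d → ℝ) (c : ℝ) (x : E d) :
    dunklLap R k (fun _ => c) x = 0 := by
  simp [dunklLap_eq, lap_eq_sum, secondDeriv_const]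

theorem dunklLap_add (R : Finset (E d)) (k : E d → ℝ) {u v : E d → ℝ} (hu : ContDiff ℝ 2 u)
    (hv : ContDiff ℝ 2 v) (x : E d) :
    dunklLap R k (fun y => u y + v y) x = dunklLap R k u x + dunklLap R k v x := by
  simp only [dunklLap_eq, lap_eq_sum, secondDeriv_add hu hv, Finset.sum_add_distrib]
  rw [add_add_add_comm, ← Finset.sum_add_distrib (s := R)]
  congr 1
  refine Finset.sum_congr rfl fun α _ => ?_
  rw [fderiv_fun_add (hu.differentiable (by norm_num) x) (hv.differentiable (by norm_num) x)]
  simp only [add_apply]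
  ring

/-- The carré du champ operator of the Dunkl Laplacian. -/
def carreDuChamp (R : Finset (E d)) (k : E d → ℝ) (u v : E d → ℝ) (x : E d) : ℝ :=
  (∑ i : Fin d, fderiv ℝ u x (EuclideanSpace.single i 1) *
      fderiv ℝ v x (EuclideanSpace.single i 1)) +
    ∑ α ∈ R, k α * (‖α‖ ^ 2 / 4 *
      ((u x - u (dunklReflect α x)) * (v x - v (dunklReflect α x)) / ⟪α, x⟫ ^ 2))

theorem dunklLap_mul (R : Finset (E d)) (k : E d → ℝ) {u v : E d → ℝ} (hu : ContDiff ℝ 2 u)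
    (hv : ContDiff ℝ 2 v) (x : E d) :
    dunklLap R k (fun y => u y * v y) x =
      u x * dunklLap R k v x + v x * dunklLap R k u x + 2 * carreDuChamp R k u v x := by
  simp only [dunklLap_eq, lap_eq_sum, secondDeriv_mul hu hv, carreDuChamp,
    Finset.sum_add_distrib, mul_add, Finset.mul_sum]
  have h : ∀ α ∈ R, k α * (fderiv ℝ (fun y => u y * v y) x α / ⟪α, x⟫ -
      ‖α‖ ^ 2 / 2 * ((u x * v x - u (dunklReflect α x) * v (dunklReflect α x)) / ⟪α, x⟫ ^ 2)) =
      u x * (k α * (fderiv ℝ v x α / ⟪α, x⟫ -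
        ‖α‖ ^ 2 / 2 * ((v x - v (dunklReflect α x)) / ⟪α, x⟫ ^ 2))) +
      v x * (k α * (fderiv ℝ u x α / ⟪α, x⟫ -
        ‖α‖ ^ 2 / 2 * ((u x - u (dunklReflect α x)) / ⟪α, x⟫ ^ 2))) +
      2 * (k α * (‖α‖ ^ 2 / 4 *
      ((u x - u (dunklReflect α x)) * (v x - v (dunklReflect α x)) / ⟪α, x⟫ ^ 2))) := by
    intro α _
    rw [fderiv_fun_mul (hu.differentiable (by norm_num) x) (hv.differentiable (by norm_num) x)]
    simp only [add_apply, smul_apply, smul_eq_mul]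
    ring
  rw [Finset.sum_congr rfl h, Finset.sum_add_distrib, Finset.sum_add_distrib]
  ring

theorem dunklLap_const_mul (R : Finset (E d)) (k : E d → ℝ) {u : E d → ℝ} (hu : ContDiff ℝ 2 u)
    (c : ℝ) (x : E d) : dunklLap R k (fun y => c * u y) x = c * dunklLap R k u x := by
  rw [dunklLap_mul R k contDiff_const hu, dunklLap_const]
  simp [carreDuChamp]

theorem carreDuChamp_of_invariant {R : Finset (E d)} (k : E d → ℝ) {u : E d → ℝ} (v : E d → ℝ)
    {x : E d} (h : ∀ α ∈ R, u (dunklReflect α x) = u x) :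
    carreDuChamp R k u v x = ∑ i : Fin d, fderiv ℝ u x (EuclideanSpace.single i 1) *
      fderiv ℝ v x (EuclideanSpace.single i 1) := by
  rw [carreDuChamp, Finset.sum_eq_zero (s := R), add_zero]
  intro α hα
  simp [h α hα]

theorem fderiv_norm_sq_eq (x a : E d) : fderiv ℝ (fun y : E d => ‖y‖ ^ 2) x a = 2 * ⟪x, a⟫ := by
  simp

theorem contDiff_norm_sq' {n : WithTop ℕ∞} : ContDiff ℝ n fun y : E d => ‖y‖ ^ 2 :=
  contDiff_norm_sq ℝ

theorem secondDeriv_norm_sq (x a : E d) :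
    secondDeriv (fun y : E d => ‖y‖ ^ 2) x a = 2 * ‖a‖ ^ 2 := by
  rw [← fderiv_fderiv_const contDiff_norm_sq']
  simp only [fderiv_norm_sq_eq]
  have h : HasFDerivAt (fun y : E d => 2 * ⟪y, a⟫) ((2 : ℝ) • innerSL ℝ a) x := by
    simpa [real_inner_comm] using ((innerSL ℝ a).hasFDerivAt (x := x)).const_mul 2
  rw [h.fderiv]
  simp

theorem secondDeriv_nonpos_of_isLocalMax {u : E d → ℝ} (hu : ContDiff ℝ 2 u) {x : E d}
    (hx : IsLocalMax u x) (a : E d) : secondDeriv u x a ≤ 0 := by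
  by_contra! hpos
  set g : ℝ → ℝ := fun s => u (x + s • a) with hg
  have hg1 : deriv g = fun s => fderiv ℝ u (x + s • a) a :=
    funext fun s => (hasDerivAt_line hu x a s).deriv
  have hg2 : ∀ s, deriv (deriv g) s = secondDeriv u (x + s • a) a := fun s => by
    rw [hg1]; exact (hasDerivAt_line_fderiv hu x a s).deriv
  have hmax : IsLocalMax g 0 := by
    have hc : Tendsto (fun s : ℝ => x + s • a) (𝓝 0) (𝓝 x) := by
      have : Continuous fun s : ℝ => x + s • a := by fun_prop
      simpa using this.tendsto 0
    have := hc.eventually hx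
    filter_upwards [this] with s hs
    simpa [hg] using hs
  have hmin : IsLocalMin g 0 := by
    refine isLocalMin_of_deriv_deriv_pos ?_ hmax.deriv_eq_zero
      (hasDerivAt_line hu x a 0).continuousAt
    rw [hg2]
    simpa using hpos
  have hconst : g =ᶠ[𝓝 0] fun _ => g 0 := by
    filter_upwards [hmax, hmin] with s h1 h2
    exact le_antisymm h1 h2
  have h0 := hconst.deriv.deriv_eq
  rw [hg2] at h0
  simp at h0
  exact hpos.ne' h0

theorem le_of_contDunklLap_eq_zero (hd : 1 ≤ d) {R : Finset (E d)} (hR0 : ∀ α ∈ R, α ≠ 0)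
    {k : E d → ℝ} (hk : ∀ α ∈ R, 0 < k α) {r : ℝ} (hr : 0 < r) {u : E d → ℝ}
    (hu : ContDiff ℝ 2 u) (hL : ∀ x, contDunklLap R k u x = 0) {M : ℝ}
    (hM : ∀ x ∈ Metric.sphere (0 : E d) r, u x ≤ M) :
    ∀ x ∈ Metric.closedBall (0 : E d) r, u x ≤ M := by
  intro x hx
  have key : ∀ ε > 0, u x ≤ M + ε * r ^ 2 := by
    intro ε hε
    set v : E d → ℝ := fun y => u y + ε * ‖y‖ ^ 2 with hv
    have hn : ContDiff ℝ 2 fun y : E d => ε * ‖y‖ ^ 2 := contDiff_const.mul contDiff_norm_sq'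
    have hvC : ContDiff ℝ 2 v := hu.add hn
    have hv2 : ∀ y a, secondDeriv v y a = secondDeriv u y a + ε * (2 * ‖a‖ ^ 2) := by
      intro y a
      rw [hv, secondDeriv_add hu hn, secondDeriv_mul contDiff_const contDiff_norm_sq',
        secondDeriv_norm_sq, secondDeriv_const]
      simp
    obtain ⟨z, hz, hmax⟩ := (isCompact_closedBall (0 : E d) r).exists_isMaxOn ⟨x, hx⟩
      hvC.continuous.continuousOn
    have hzr : ‖z‖ = r := by
      by_contra hne
      have hlt : ‖z‖ < r := lt_of_le_of_ne (by simpa using hz) hne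
      have hloc : IsLocalMax v z := hmax.isLocalMax
        (mem_of_superset (Metric.isOpen_ball.mem_nhds (by simpa using hlt))
          Metric.ball_subset_closedBall)
      have h2 : ∀ a, secondDeriv u z a ≤ -(ε * (2 * ‖a‖ ^ 2)) := fun a => by
        have := secondDeriv_nonpos_of_isLocalMax hvC hloc a
        rw [hv2] at this
        linarith
      have hgrad : ∀ a, fderiv ℝ u z a = -(ε * (2 * ⟪z, a⟫)) := fun a => by
        have h0 := congrArg (fun l => l a) hloc.fderiv_eq_zero
        simp only [hv] at h0
        rw [fderiv_fun_add (hu.differentiable (by norm_num) z)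
          (hn.differentiable (by norm_num) z),
            fderiv_const_mul (contDiff_norm_sq'.differentiable one_ne_zero z)] at h0
        simp only [add_apply, smul_apply, fderiv_norm_sq_eq, smul_eq_mul, zero_apply] at h0
        linarith
      have hlap : lap u z < 0 := by
        rw [lap_eq_sum]
        refine Finset.sum_neg (fun i _ => ?_) ⟨⟨0, hd⟩, Finset.mem_univ _⟩
        have := h2 (EuclideanSpace.single i 1)
        simp at this
        linarith
      have hroot : ∀ α ∈ R, k α * rootTerm α u z ≤ 0 := by
        intro α hα
        refine mul_nonpos_of_nonneg_of_nonpos (hk α hα).le ?_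
        by_cases ht : ⟪α, z⟫ = 0
        · rw [rootTerm_of_inner_eq_zero u ht]
          refine div_nonpos_of_nonpos_of_nonneg ((h2 α).trans ?_) (by positivity)
          rw [neg_nonpos]
          positivity
        · have h := sq_mul_rootTerm (hR0 α hα) hu z
          have hle : v (dunklReflect α z) ≤ v z := hmax (by simpa [norm_dunklReflect] using hz)
          simp only [hv, norm_dunklReflect] at hle
          rw [hgrad, real_inner_comm α z] at h
          have hp : 0 < ⟪α, z⟫ ^ 2 := by positivity
          have : 0 ≤ ‖α‖ ^ 2 / 2 * (u z - u (dunklReflect α z)) :=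
            mul_nonneg (by positivity) (by linarith)
          by_contra! hc
          have := mul_pos hp hc
          nlinarith
      have := hL z
      rw [contDunklLap] at this
      linarith [Finset.sum_nonpos hroot]
    have h1 : v x ≤ v z := hmax hx
    have h2 := hM z (by simpa using hzr)
    simp only [hv, hzr] at h1
    nlinarith [mul_nonneg hε.le (sq_nonneg ‖x‖)]
  refine le_of_forall_pos_le_add fun η hη => ?_
  have := key (η / r ^ 2) (by positivity)
  rwa [div_mul_cancel₀ _ (by positivity)] at this

end Algebra

section Symmetry

variable {d : ℕ}

/-- A smooth positive regularization of the weight function. -/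
def regWeight (R : Finset (E d)) (k : E d → ℝ) (ε : ℝ) (x : E d) : ℝ :=
  exp (∑ α ∈ R, k α / 2 * log (⟪α, x⟫ ^ 2 + ε ^ 2))

theorem regWeight_pos (R : Finset (E d)) (k : E d → ℝ) (ε : ℝ) (x : E d) :
    0 < regWeight R k ε x := exp_pos _

theorem hasFDerivAt_regWeight (R : Finset (E d)) (k : E d → ℝ) {ε : ℝ} (hε : 0 < ε) (x : E d) :
    HasFDerivAt (regWeight R k ε) (regWeight R k ε x •
      ∑ α ∈ R, (k α * (⟪α, x⟫ / (⟪α, x⟫ ^ 2 + ε ^ 2))) • innerSL ℝ α) x := by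
  refine HasFDerivAt.exp (HasFDerivAt.fun_sum fun α _ => ?_)
  have h1 : HasFDerivAt (fun y : E d => ⟪α, y⟫) (innerSL ℝ α) x := (innerSL ℝ α).hasFDerivAt
  have h2 := (((h1.pow 2).add_const (ε ^ 2)).log (by positivity)).const_mul (k α / 2)
  refine h2.congr_fderiv ?_
  ext v
  simp only [smul_apply, smul_eq_mul, innerSL_apply_apply, nsmul_eq_mul]
  push_cast
  field_simp

theorem fderiv_regWeight (R : Finset (E d)) (k : E d → ℝ) {ε : ℝ} (hε : 0 < ε) (x v : E d) :
    fderiv ℝ (regWeight R k ε) x v = regWeight R k ε x *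
      ∑ α ∈ R, k α * (⟪α, x⟫ / (⟪α, x⟫ ^ 2 + ε ^ 2)) * ⟪α, v⟫ := by
  rw [(hasFDerivAt_regWeight R k hε x).fderiv]
  simp

theorem contDiff_inner_left (α : E d) {n : WithTop ℕ∞} : ContDiff ℝ n fun x : E d => ⟪α, x⟫ :=
  contDiff_const.inner ℝ contDiff_id

theorem contDiff_regWeight (R : Finset (E d)) (k : E d → ℝ) {ε : ℝ} (hε : 0 < ε)
    {n : WithTop ℕ∞} : ContDiff ℝ n (regWeight R k ε) :=
  ContDiff.exp (ContDiff.sum fun α _ => contDiff_const.mul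
    (ContDiff.log (((contDiff_inner_left α).pow 2).add contDiff_const) fun x => by positivity))

theorem regWeight_dunklReflect {R : Finset (E d)}
    (hRrefl : ∀ α ∈ R, ∀ β ∈ R, dunklReflect α β ∈ R) {k : E d → ℝ}
    (hkinv : ∀ α ∈ R, ∀ β ∈ R, k (dunklReflect α β) = k β) (ε : ℝ) {β : E d} (hβ : β ∈ R)
    (x : E d) : regWeight R k ε (dunklReflect β x) = regWeight R k ε x := by
  rw [regWeight, regWeight]
  congr 1
  refine Finset.sum_nbij' (dunklReflect β) (dunklReflect β) (fun α hα => hRrefl β hβ α hα)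
    (fun α hα => hRrefl β hβ α hα) (fun α _ => dunklReflect_dunklReflect β α)
    (fun α _ => dunklReflect_dunklReflect β α) fun α hα => ?_
  rw [hkinv β hβ α hα, inner_dunklReflect_right]

theorem regWeight_le {R : Finset (E d)} {k : E d → ℝ} (hk : ∀ α ∈ R, 0 < k α) {ε : ℝ}
    (hε : 0 < ε) (hε1 : ε ≤ 1) (x : E d) : regWeight R k ε x ≤ regWeight R k 1 x := by
  refine exp_le_exp.2 (Finset.sum_le_sum fun α hα => mul_le_mul_of_nonneg_left
    (log_le_log (by positivity) ?_) (div_nonneg (hk α hα).le zero_le_two))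
  have : ε ^ 2 ≤ 1 ^ 2 := by gcongr
  linarith

theorem tendsto_regWeight {R : Finset (E d)} (k : E d → ℝ) {x : E d} (hx : x ∈ regularSet R) :
    Tendsto (fun ε => regWeight R k ε x) (𝓝 0) (𝓝 (wk R k x)) := by
  have h : wk R k x = exp (∑ α ∈ R, k α / 2 * log (⟪α, x⟫ ^ 2 + 0 ^ 2)) := by
    rw [exp_sum, wk]
    refine Finset.prod_congr rfl fun α hα => ?_
    rw [real_inner_comm, rpow_def_of_pos (abs_pos.2 (hx α hα)), log_abs]
    congr 1
    rw [zero_pow two_ne_zero, add_zero, log_pow]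
    push_cast
    ring
  rw [h]
  refine (continuous_exp.tendsto _).comp (tendsto_finsetSum _ fun α hα => ?_)
  have hne : ⟪α, x⟫ ^ 2 + 0 ^ 2 ≠ 0 := by simpa using hx α hα
  exact ((((continuous_const.add (continuous_pow 2)).tendsto 0)).log hne).const_mul _

theorem continuous_wk {R : Finset (E d)} {k : E d → ℝ} (hk : ∀ α ∈ R, 0 < k α) :
    Continuous (wk R k) := by
  refine continuous_finsetProd _ fun α hα => Continuous.rpow_const ?_ fun _ => Or.inr (hk α hα).le
  exact (continuous_id.inner continuous_const).abs

theorem wk_nonneg (R : Finset (E d)) (k : E d → ℝ) (x : E d) : 0 ≤ wk R k x :=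
  Finset.prod_nonneg fun _ _ => rpow_nonneg (abs_nonneg _) _

theorem wk_pos {R : Finset (E d)} (k : E d → ℝ) {x : E d} (hx : x ∈ regularSet R) :
    0 < wk R k x :=
  Finset.prod_pos fun α hα => rpow_pos_of_pos (abs_pos.2 (by
    rw [real_inner_comm]; exact hx α hα)) _

theorem integral_mul_div_symm {w h ψ : E d → ℝ} (hw : ContDiff ℝ 1 w) (hh : ContDiff ℝ 2 h)
    (hψ : ContDiff ℝ 2 ψ) (hc : HasCompactSupport ψ) (v : E d) :
    ∫ x, h x * (w x * secondDeriv ψ x v + fderiv ℝ w x v * fderiv ℝ ψ x v) =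
      ∫ x, ψ x * (w x * secondDeriv h x v + fderiv ℝ w x v * fderiv ℝ h x v) := by
  have hw1 : Differentiable ℝ w := hw.differentiable (by norm_num)
  have hwc : Continuous w := hw.continuous
  have hdw : Continuous fun x => fderiv ℝ w x v :=
    (hw.continuous_fderiv (by norm_num)).clm_apply continuous_const
  have hF : ∀ {u : E d → ℝ}, ContDiff ℝ 2 u → ∀ x, fderiv ℝ (fun y => w y * fderiv ℝ u y v) x v =
      w x * secondDeriv u x v + fderiv ℝ w x v * fderiv ℝ u x v := by
    intro u hu x
    rw [fderiv_fun_mul (hw1 x) ((contDiff_fderiv_const hu v).differentiable (by norm_num) x)]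
    simp only [add_apply, smul_apply, smul_eq_mul, fderiv_fderiv_const hu]
    ring
  have hFc : ∀ {u : E d → ℝ}, ContDiff ℝ 2 u → Continuous fun x =>
      w x * secondDeriv u x v + fderiv ℝ w x v * fderiv ℝ u x v := fun hu =>
    (hwc.mul (continuous_secondDeriv hu v)).add (hdw.mul (continuous_fderiv_const hu v))
  have hcd : HasCompactSupport fun x => fderiv ℝ ψ x v := hc.fderiv_apply (𝕜 := ℝ) v
  have hcF : HasCompactSupport fun y => w y * fderiv ℝ ψ y v := hcd.mul_left
  have hcdF : HasCompactSupport fun x =>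
      w x * secondDeriv ψ x v + fderiv ℝ w x v * fderiv ℝ ψ x v := by
    simpa only [hF hψ] using hcF.fderiv_apply (𝕜 := ℝ) v
  have hD : ∀ {u : E d → ℝ}, ContDiff ℝ 2 u → Differentiable ℝ fun y => w y * fderiv ℝ u y v :=
    fun hu => hw1.fun_mul ((contDiff_fderiv_const hu v).differentiable (by norm_num))
  have i1 := integral_mul_fderiv_eq_neg_fderiv_mul_of_integrable (μ := (volume : Measure (E d)))
    (f := h) (g := fun y => w y * fderiv ℝ ψ y v) (v := v)
    (((continuous_fderiv_const hh v).mul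
      (hwc.mul (continuous_fderiv_const hψ v))).integrable_of_hasCompactSupport hcF.mul_left)
    (by
      simp only [hF hψ]
      exact (hh.continuous.mul (hFc hψ)).integrable_of_hasCompactSupport hcdF.mul_left)
    ((hh.continuous.mul
      (hwc.mul (continuous_fderiv_const hψ v))).integrable_of_hasCompactSupport hcF.mul_left)
    (fun x _ => hh.differentiable (by norm_num) x) (fun x _ => hD hψ x)
  have i2 := integral_mul_fderiv_eq_neg_fderiv_mul_of_integrable (μ := (volume : Measure (E d)))
    (f := ψ) (g := fun y => w y * fderiv ℝ h y v) (v := v)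
    (((continuous_fderiv_const hψ v).mul
      (hwc.mul (continuous_fderiv_const hh v))).integrable_of_hasCompactSupport hcd.mul_right)
    (by
      simp only [hF hh]
      exact (hψ.continuous.mul (hFc hh)).integrable_of_hasCompactSupport hc.mul_right)
    ((hψ.continuous.mul
      (hwc.mul (continuous_fderiv_const hh v))).integrable_of_hasCompactSupport hc.mul_right)
    (fun x _ => hψ.differentiable (by norm_num) x) (fun x _ => hD hh x)
  simp only [hF hψ] at i1
  simp only [hF hh] at i2
  rw [i1, i2]
  congr 2
  funext x
  ring

theorem hasCompactSupport_comp_dunklReflect {ψ : E d → ℝ} (hc : HasCompactSupport ψ) (α : E d) :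
    HasCompactSupport fun x => ψ (dunklReflect α x) := by
  refine HasCompactSupport.intro (IsCompact.image hc (continuous_dunklReflect α)) fun x hx => ?_
  by_contra hne
  exact hx ⟨dunklReflect α x, subset_tsupport ψ hne, dunklReflect_dunklReflect α x⟩

theorem integral_mul_sub_reflect_symm {g h ψ : E d → ℝ} (hg : Continuous g) (hh : Continuous h)
    (hψ : Continuous ψ) (hc : HasCompactSupport ψ) {α : E d}
    (hgα : ∀ x, g (dunklReflect α x) = g x) :
    ∫ x, h x * (g x * (ψ x - ψ (dunklReflect α x))) =
      ∫ x, ψ x * (g x * (h x - h (dunklReflect α x))) := by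
  have hσ := continuous_dunklReflect α
  have hint : ∀ {u : E d → ℝ}, Continuous u → Integrable fun x => ψ x * (g x * u x) :=
    fun hu => (hψ.mul (hg.mul hu)).integrable_of_hasCompactSupport hc.mul_right
  have hcσ := hasCompactSupport_comp_dunklReflect hc α
  have hsw := integral_comp_dunklReflect α fun x => ψ x * (g x * h (dunklReflect α x))
  simp only [hgα, dunklReflect_dunklReflect] at hsw
  have hi : Integrable fun x => ψ (dunklReflect α x) * (g x * h x) :=
    ((hψ.comp hσ).mul (hg.mul hh)).integrable_of_hasCompactSupport hcσ.mul_right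
  have hi' : Integrable fun x => ψ x * (g x * h (dunklReflect α x)) := hint (hh.comp hσ)
  have e1 : (fun x => h x * (g x * (ψ x - ψ (dunklReflect α x)))) = fun x =>
      ψ x * (g x * h x) - ψ (dunklReflect α x) * (g x * h x) := by funext x; ring
  have e2 : (fun x => ψ x * (g x * (h x - h (dunklReflect α x)))) = fun x =>
      ψ x * (g x * h x) - ψ x * (g x * h (dunklReflect α x)) := by funext x; ring
  rw [e1, e2, integral_sub (hint hh) hi, integral_sub (hint hh) hi', hsw]

/-- The regularization of the Dunkl Laplacian that is symmetric with respect to `regWeight`. -/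
def regDunklLap (R : Finset (E d)) (k : E d → ℝ) (ε : ℝ) (u : E d → ℝ) (x : E d) : ℝ :=
  lap u x + ∑ α ∈ R, k α * (⟪α, x⟫ ^ 2 / (⟪α, x⟫ ^ 2 + ε ^ 2) * rootTerm α u x)

theorem regDunklLap_mul_regWeight {R : Finset (E d)} (hR0 : ∀ α ∈ R, α ≠ 0) (k : E d → ℝ) {ε : ℝ}
    (hε : 0 < ε) {u : E d → ℝ} (hu : ContDiff ℝ 2 u) (x : E d) :
    regDunklLap R k ε u x * regWeight R k ε x =
      (∑ i : Fin d, (regWeight R k ε x * secondDeriv u x (EuclideanSpace.single i 1) +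
        fderiv ℝ (regWeight R k ε) x (EuclideanSpace.single i 1) *
          fderiv ℝ u x (EuclideanSpace.single i 1))) -
      ∑ α ∈ R, k α * (‖α‖ ^ 2 / 2) * (regWeight R k ε x / (⟪α, x⟫ ^ 2 + ε ^ 2) *
        (u x - u (dunklReflect α x))) := by
  have hroot : ∀ α ∈ R, k α * (⟪α, x⟫ ^ 2 / (⟪α, x⟫ ^ 2 + ε ^ 2) * rootTerm α u x) *
      regWeight R k ε x =
      regWeight R k ε x * (k α * (⟪α, x⟫ / (⟪α, x⟫ ^ 2 + ε ^ 2)) * fderiv ℝ u x α) -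
        k α * (‖α‖ ^ 2 / 2) * (regWeight R k ε x / (⟪α, x⟫ ^ 2 + ε ^ 2) *
          (u x - u (dunklReflect α x))) := by
    intro α hα
    rw [div_mul_eq_mul_div, sq_mul_rootTerm (hR0 α hα) hu]
    ring
  have hexp : ∀ α : E d, fderiv ℝ u x α =
      ∑ i : Fin d, ⟪α, EuclideanSpace.single i 1⟫ * fderiv ℝ u x (EuclideanSpace.single i 1) := by
    intro α
    conv_lhs => rw [← (EuclideanSpace.basisFun (Fin d) ℝ).sum_repr' α]
    simp [real_inner_comm]
  rw [regDunklLap, add_mul, Finset.sum_mul, Finset.sum_congr rfl hroot, Finset.sum_sub_distrib,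
    Finset.sum_add_distrib, lap_eq_sum]
  have : ∑ α ∈ R, regWeight R k ε x *
      (k α * (⟪α, x⟫ / (⟪α, x⟫ ^ 2 + ε ^ 2)) * fderiv ℝ u x α) =
      ∑ i : Fin d, fderiv ℝ (regWeight R k ε) x (EuclideanSpace.single i 1) *
          fderiv ℝ u x (EuclideanSpace.single i 1) := by
    simp only [fderiv_regWeight R k hε, Finset.sum_mul, Finset.mul_sum]
    rw [Finset.sum_comm]
    refine Finset.sum_congr rfl fun α _ => ?_
    rw [hexp α, Finset.mul_sum, Finset.mul_sum]
    refine Finset.sum_congr rfl fun i _ => ?_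
    ring
  rw [this, ← Finset.mul_sum]
  ring

theorem integral_regDunklLap_symm {R : Finset (E d)} (hR0 : ∀ α ∈ R, α ≠ 0)
    (hRrefl : ∀ α ∈ R, ∀ β ∈ R, dunklReflect α β ∈ R) {k : E d → ℝ}
    (hkinv : ∀ α ∈ R, ∀ β ∈ R, k (dunklReflect α β) = k β) {ε : ℝ} (hε : 0 < ε)
    {h ψ : E d → ℝ} (hh : ContDiff ℝ 2 h) (hψ : ContDiff ℝ 2 ψ) (hc : HasCompactSupport ψ) :
    ∫ x, h x * (regDunklLap R k ε ψ x * regWeight R k ε x) =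
      ∫ x, ψ x * (regDunklLap R k ε h x * regWeight R k ε x) := by
  set w := regWeight R k ε with hw
  have hwC : ContDiff ℝ 1 w := contDiff_regWeight R k hε
  have hdw : ∀ v, Continuous fun x => fderiv ℝ w x v := fun v =>
    (hwC.continuous_fderiv (by norm_num)).clm_apply continuous_const
  have hg : ∀ α : E d, Continuous fun x => w x / (⟪α, x⟫ ^ 2 + ε ^ 2) := fun α =>
    hwC.continuous.div (((contDiff_inner_left α (n := 0)).continuous.pow 2).add continuous_const)
      fun x => by positivity
  have hgσ : ∀ α ∈ R, ∀ x, w (dunklReflect α x) / (⟪α, dunklReflect α x⟫ ^ 2 + ε ^ 2) =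
      w x / (⟪α, x⟫ ^ 2 + ε ^ 2) := fun α hα x => by
    rw [hw, regWeight_dunklReflect hRrefl hkinv ε hα, inner_self_dunklReflect, neg_sq]
  have hTc : ∀ {u : E d → ℝ}, ContDiff ℝ 2 u → ∀ v, Continuous fun x =>
      w x * secondDeriv u x v + fderiv ℝ w x v * fderiv ℝ u x v := fun hu v =>
    (hwC.continuous.mul (continuous_secondDeriv hu v)).add
      ((hdw v).mul (continuous_fderiv_const hu v))
  have hSc : ∀ {u : E d → ℝ}, ContDiff ℝ 2 u → ∀ α : E d, Continuous fun x =>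
      w x / (⟪α, x⟫ ^ 2 + ε ^ 2) * (u x - u (dunklReflect α x)) := fun hu α =>
    (hg α).mul (hu.continuous.sub (hu.continuous.comp (continuous_dunklReflect α)))
  have hcT : ∀ v, HasCompactSupport fun x =>
      w x * secondDeriv ψ x v + fderiv ℝ w x v * fderiv ℝ ψ x v := by
    intro v
    have hcd : HasCompactSupport fun x => fderiv ℝ ψ x v := hc.fderiv_apply (𝕜 := ℝ) v
    have hcs : HasCompactSupport fun x => secondDeriv ψ x v := by
      simpa only [fderiv_fderiv_const hψ] using hcd.fderiv_apply (𝕜 := ℝ) v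
    exact (hcs.mul_left (f := w)).add (hcd.mul_left (f := fun x => fderiv ℝ w x v))
  have hcS : ∀ α : E d, HasCompactSupport fun x =>
      w x / (⟪α, x⟫ ^ 2 + ε ^ 2) * (ψ x - ψ (dunklReflect α x)) := by
    intro α
    exact (hc.sub (hasCompactSupport_comp_dunklReflect hc α)).mul_left
  have expand : ∀ {u v : E d → ℝ}, ContDiff ℝ 2 v →
      (∀ i : Fin d, Integrable fun x => u x * (w x * secondDeriv v x (EuclideanSpace.single i 1) +
        fderiv ℝ w x (EuclideanSpace.single i 1) * fderiv ℝ v x (EuclideanSpace.single i 1))) →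
      (∀ α : E d, Integrable fun x => u x * (w x / (⟪α, x⟫ ^ 2 + ε ^ 2) *
        (v x - v (dunklReflect α x)))) →
      ∫ x, u x * (regDunklLap R k ε v x * w x) =
        (∑ i : Fin d, ∫ x, u x * (w x * secondDeriv v x (EuclideanSpace.single i 1) +
        fderiv ℝ w x (EuclideanSpace.single i 1) * fderiv ℝ v x (EuclideanSpace.single i 1))) -
        ∑ α ∈ R, k α * (‖α‖ ^ 2 / 2) * ∫ x, u x * (w x / (⟪α, x⟫ ^ 2 + ε ^ 2) *
        (v x - v (dunklReflect α x))) := by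
    intro u v hv h1 h2
    simp only [hw, regDunklLap_mul_regWeight hR0 k hε hv]
    simp only [← hw, mul_sub, Finset.mul_sum]
    simp only [← mul_sub, mul_left_comm (u _) (k _ * _)]
    rw [integral_sub (integrable_finsetSum _ fun i _ => h1 i)
      (integrable_finsetSum _ fun α _ => (h2 α).const_mul _),
      integral_finsetSum _ fun i _ => h1 i,
      integral_finsetSum _ fun α _ => (h2 α).const_mul _]
    simp only [integral_const_mul]
  rw [expand hψ
      (fun i => (hh.continuous.mul (hTc hψ _)).integrable_of_hasCompactSupport (hcT _).mul_left)
      (fun α => (hh.continuous.mul (hSc hψ _)).integrable_of_hasCompactSupport (hcS _).mul_left),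
    expand hh
      (fun i => (hψ.continuous.mul (hTc hh _)).integrable_of_hasCompactSupport hc.mul_right)
      (fun α => (hψ.continuous.mul (hSc hh _)).integrable_of_hasCompactSupport hc.mul_right)]
  congr 1
  · exact Finset.sum_congr rfl fun i _ => integral_mul_div_symm hwC hh hψ hc _
  · refine Finset.sum_congr rfl fun α hα => ?_
    rw [integral_mul_sub_reflect_symm (hg α) hh.continuous hψ.continuous hc (hgσ α hα)]

end Symmetry

section WeakHarmonic

variable {d : ℕ}

theorem ContinuousOn.integrableOn_ball_of_closure {f : E d → ℝ} {r : ℝ} (hr : 0 < r)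
    (hf : ContinuousOn f (closure (Metric.ball 0 r))) : IntegrableOn f (Metric.ball 0 r) := by
  rw [closure_ball _ hr.ne'] at hf
  exact (hf.integrableOn_compact (isCompact_closedBall _ _)).mono_set Metric.ball_subset_closedBall

theorem continuous_regDunklLap (R : Finset (E d)) (k : E d → ℝ) {ε : ℝ} (hε : 0 < ε)
    {u : E d → ℝ} (hu : ContDiff ℝ 2 u) : Continuous (regDunklLap R k ε u) := by
  refine (continuous_lap hu).add (continuous_finsetSum _ fun α _ => continuous_const.mul
    (Continuous.mul (Continuous.div ?_ ?_ fun x => by positivity) (continuous_rootTerm α hu)))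
  · exact (contDiff_inner_left α (n := 0)).continuous.pow 2
  · exact ((contDiff_inner_left α (n := 0)).continuous.pow 2).add continuous_const

theorem tendsto_integral_regDunklLap {R : Finset (E d)} (hR0 : ∀ α ∈ R, α ≠ 0) {k : E d → ℝ}
    (hk : ∀ α ∈ R, 0 < k α) {r : ℝ} (hr : 0 < r) {f u : E d → ℝ} (hf : Continuous f)
    (hu : ContDiff ℝ 2 u) :
    Tendsto (fun n : ℕ => ∫ x in Metric.ball (0 : E d) r,
        f x * (regDunklLap R k (1 / ((n : ℝ) + 1)) u x * regWeight R k (1 / ((n : ℝ) + 1)) x))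
      atTop (𝓝 (∫ x in Metric.ball (0 : E d) r, f x * (contDunklLap R k u x * wk R k x))) := by
  have hpos : ∀ n : ℕ, (0 : ℝ) < 1 / ((n : ℝ) + 1) := fun n => Nat.one_div_pos_of_nat
  have hle : ∀ n : ℕ, 1 / ((n : ℝ) + 1) ≤ 1 := fun n => by
    rw [div_le_one (by positivity)]
    linarith [n.cast_nonneg (α := ℝ)]
  have hlim : Tendsto (fun n : ℕ => 1 / ((n : ℝ) + 1)) atTop (𝓝 0) :=
    tendsto_one_div_add_atTop_nhds_zero_nat
  refine tendsto_integral_of_dominated_convergence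
    (fun x => |f x| * ((|lap u x| + ∑ α ∈ R, k α * |rootTerm α u x|) * regWeight R k 1 x))
    (fun n => ?_) ?_ (fun n => ?_) ?_
  · exact (hf.mul ((continuous_regDunklLap R k (hpos n) hu).mul
      (contDiff_regWeight R k (hpos n) (n := 0)).continuous)).aestronglyMeasurable
  · refine ContinuousOn.integrableOn_ball_of_closure hr (Continuous.continuousOn ?_)
    exact hf.abs.mul (((continuous_lap hu).abs.add (continuous_finsetSum _ fun α _ =>
      continuous_const.mul (continuous_rootTerm α hu).abs)).mul
      (contDiff_regWeight R k one_pos (n := 0)).continuous)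
  · refine Eventually.of_forall fun x => ?_
    rw [norm_mul, norm_mul, norm_eq_abs, norm_eq_abs, norm_eq_abs,
      abs_of_pos (regWeight_pos R k _ x)]
    refine mul_le_mul_of_nonneg_left (mul_le_mul ?_ (regWeight_le hk (hpos n) (hle n) x)
      (regWeight_pos R k _ x).le (add_nonneg (abs_nonneg _) (Finset.sum_nonneg fun α hα =>
        mul_nonneg (hk α hα).le (abs_nonneg _)))) (abs_nonneg _)
    · refine (abs_add_le _ _).trans (add_le_add le_rfl
        ((Finset.abs_sum_le_sum_abs _ _).trans (Finset.sum_le_sum fun α hα => ?_)))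
      rw [abs_mul, abs_mul, abs_of_pos (hk α hα), abs_of_nonneg (by positivity)]
      refine mul_le_mul_of_nonneg_left (mul_le_of_le_one_left (abs_nonneg _) ?_) (hk α hα).le
      exact div_le_one_of_le₀ (by linarith [sq_nonneg (1 / ((n : ℝ) + 1))]) (by positivity)
  · filter_upwards [ae_restrict_of_ae (ae_mem_regularSet hR0)] with x hx
    refine Tendsto.const_mul _ (Tendsto.mul ?_ ((tendsto_regWeight k hx).comp hlim))
    refine Tendsto.add tendsto_const_nhds (tendsto_finsetSum _ fun α hα => Tendsto.const_mul _ ?_)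
    have hne : ⟪α, x⟫ ^ 2 + (0 : ℝ) ^ 2 ≠ 0 := by simpa using hx α hα
    have h1 : Tendsto (fun n : ℕ => ⟪α, x⟫ ^ 2 / (⟪α, x⟫ ^ 2 + (1 / ((n : ℝ) + 1)) ^ 2)) atTop
        (𝓝 (⟪α, x⟫ ^ 2 / (⟪α, x⟫ ^ 2 + (0 : ℝ) ^ 2))) :=
      tendsto_const_nhds.div (tendsto_const_nhds.add (hlim.pow 2)) hne
    have h2 : ⟪α, x⟫ ^ 2 / (⟪α, x⟫ ^ 2 + (0 : ℝ) ^ 2) = 1 := by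
      rw [zero_pow two_ne_zero, add_zero, div_self]
      simpa using hne
    rw [h2] at h1
    simpa using h1.mul_const (rootTerm α u x)

theorem setIntegral_dunklLap_eq {R : Finset (E d)} (hR0 : ∀ α ∈ R, α ≠ 0) (k : E d → ℝ)
    (f : E d → ℝ) {u : E d → ℝ} (hu : ContDiff ℝ 2 u) (s : Set (E d)) :
    ∫ x in s, f x * dunklLap R k u x * wk R k x =
      ∫ x in s, f x * (contDunklLap R k u x * wk R k x) := by
  refine integral_congr_ae ?_
  filter_upwards [ae_restrict_of_ae (ae_mem_regularSet hR0)] with x hx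
  rw [contDunklLap_eq_dunklLap hR0 k hu hx, mul_assoc]

theorem isDunklHarmonic_of_contDunklLap_eq_zero {R : Finset (E d)} (hR0 : ∀ α ∈ R, α ≠ 0)
    (hRrefl : ∀ α ∈ R, ∀ β ∈ R, dunklReflect α β ∈ R) {k : E d → ℝ} (hk : ∀ α ∈ R, 0 < k α)
    (hkinv : ∀ α ∈ R, ∀ β ∈ R, k (dunklReflect α β) = k β) {r : ℝ} (hr : 0 < r)
    {h : E d → ℝ} (hh : ContDiff ℝ 2 h) (hL : ∀ x, contDunklLap R k h x = 0) :
    IsDunklHarmonic R k (Metric.ball 0 r) h := by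
  intro ψ hψ hc hsupp
  have hψ2 : ContDiff ℝ 2 ψ := by exact_mod_cast contDiff_infty.1 hψ 2
  have hzero : ∀ x ∉ Metric.ball (0 : E d) r, ψ x = 0 := fun x hx =>
    image_eq_zero_of_notMem_tsupport fun hx' => hx (hsupp hx')
  rw [setIntegral_dunklLap_eq hR0 k h hψ2]
  have h1 := tendsto_integral_regDunklLap hR0 hk hr hh.continuous hψ2
  have h2 := tendsto_integral_regDunklLap hR0 hk hr hψ.continuous hh
  simp only [hL, zero_mul, mul_zero, integral_zero] at h2
  refine tendsto_nhds_unique h1 (h2.congr fun n => ?_)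
  have hpos : (0 : ℝ) < 1 / ((n : ℝ) + 1) := Nat.one_div_pos_of_nat
  rw [setIntegral_eq_integral_of_forall_compl_eq_zero fun x hx => by rw [hzero x hx, zero_mul],
    setIntegral_eq_integral_of_forall_compl_eq_zero,
    integral_regDunklLap_symm hR0 hRrefl hkinv hpos hh hψ2 hc]
  intro x hx
  have hloc : ψ =ᶠ[𝓝 x] fun _ => 0 :=
    notMem_tsupport_iff_eventuallyEq.1 fun hx' => hx (hsupp hx')
  have hlap : lap ψ x = 0 := by
    simp [lap_eq_sum, secondDeriv, hloc.fderiv.fderiv_eq]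
  have : regDunklLap R k (1 / ((n : ℝ) + 1)) ψ x = 0 := by
    rw [regDunklLap, hlap, zero_add]
    refine Finset.sum_eq_zero fun α hα => ?_
    rw [div_mul_eq_mul_div, sq_mul_rootTerm (hR0 α hα) hψ2, hloc.fderiv_eq, hzero x hx,
      hzero (dunklReflect α x) (by simpa [norm_dunklReflect] using hx)]
    simp
  rw [this, zero_mul, mul_zero]

end WeakHarmonic

section Polynomials

variable {d : ℕ}

/-- The monomial given by a list of coordinates. -/
def coordMonomial (L : List (Fin d)) (x : E d) : ℝ := (L.map fun i => x i).prod

/-- The polynomial functions of degree less than `n`. -/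
def polyDegLT (d n : ℕ) : Submodule ℝ (E d → ℝ) :=
  Submodule.span ℝ (coordMonomial '' {L : List (Fin d) | L.length < n})

theorem coordMonomial_nil : coordMonomial ([] : List (Fin d)) = fun _ => 1 := by
  funext x
  simp [coordMonomial]

theorem coordMonomial_cons (i : Fin d) (L : List (Fin d)) :
    coordMonomial (i :: L) = fun x => x i * coordMonomial L x := by
  funext x
  simp [coordMonomial]

theorem coordMonomial_mem {L : List (Fin d)} {n : ℕ} (h : L.length < n) :
    coordMonomial L ∈ polyDegLT d n :=
  Submodule.subset_span ⟨L, h, rfl⟩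

theorem polyDegLT_mono {m n : ℕ} (h : m ≤ n) : polyDegLT d m ≤ polyDegLT d n :=
  Submodule.span_mono (Set.image_mono fun _ hL => lt_of_lt_of_le hL h)

instance finiteDimensional_polyDegLT (n : ℕ) : FiniteDimensional ℝ (polyDegLT d n) :=
  FiniteDimensional.span_of_finite ℝ ((List.finite_length_lt (Fin d) n).image _)

theorem polyDegLT_induction {n : ℕ} {P : (E d → ℝ) → Prop}
    (hmonomial : ∀ L : List (Fin d), L.length < n → P (coordMonomial L)) (hzero : P 0)
    (hadd : ∀ p ∈ polyDegLT d n, ∀ q ∈ polyDegLT d n, P p → P q → P (p + q))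
    (hsmul : ∀ (c : ℝ), ∀ p ∈ polyDegLT d n, P p → P (c • p)) {p : E d → ℝ}
    (hp : p ∈ polyDegLT d n) : P p := by
  refine Submodule.span_induction (p := fun p _ => P p) ?_ hzero
    (fun p q hp hq => hadd p hp q hq) (fun c p hp => hsmul c p hp) hp
  rintro _ ⟨L, hL, rfl⟩
  exact hmonomial L hL

theorem contDiff_coord (i : Fin d) {m : WithTop ℕ∞} : ContDiff ℝ m fun x : E d => x i :=
  (EuclideanSpace.proj (𝕜 := ℝ) i).contDiff

theorem contDiff_coordMonomial (L : List (Fin d)) {m : WithTop ℕ∞} :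
    ContDiff ℝ m (coordMonomial L) := by
  induction L with
  | nil => rw [coordMonomial_nil]; exact contDiff_const
  | cons i L ih => rw [coordMonomial_cons]; exact (contDiff_coord i).mul ih

theorem contDiff_of_mem_polyDegLT {n : ℕ} {p : E d → ℝ} (hp : p ∈ polyDegLT d n)
    {m : WithTop ℕ∞} : ContDiff ℝ m p :=
  polyDegLT_induction (fun L _ => contDiff_coordMonomial L) contDiff_const
    (fun _ _ _ _ h1 h2 => h1.add h2) (fun _ _ _ h => contDiff_const.smul h) hp

theorem coord_mul_mem {n : ℕ} {p : E d → ℝ} (hp : p ∈ polyDegLT d n) (i : Fin d) :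
    (fun x => x i * p x) ∈ polyDegLT d (n + 1) := by
  refine polyDegLT_induction (P := fun p => (fun x => x i * p x) ∈ polyDegLT d (n + 1))
    (fun L hL => ?_) ?_ (fun p _ q _ h1 h2 => ?_) (fun c p _ h => ?_) hp
  · rw [← coordMonomial_cons]
    exact coordMonomial_mem (by simpa using hL)
  · convert Submodule.zero_mem (polyDegLT d (n + 1)) using 1
    funext x
    simp
  · convert Submodule.add_mem _ h1 h2 using 1
    funext x
    simp [mul_add]
  · convert Submodule.smul_mem _ c h using 1
    funext x
    simp [mul_left_comm]

theorem inner_mul_mem {n : ℕ} {p : E d → ℝ} (hp : p ∈ polyDegLT d n) (v : E d) :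
    (fun x => ⟪v, x⟫ * p x) ∈ polyDegLT d (n + 1) := by
  have h : (fun x => ⟪v, x⟫ * p x) = ∑ i : Fin d, v i • fun x : E d => x i * p x := by
    funext x
    simp only [PiLp.inner_apply, Finset.sum_apply, Pi.smul_apply, smul_eq_mul, Finset.sum_mul]
    refine Finset.sum_congr rfl fun i _ => ?_
    simp
    ring
  rw [h]
  exact Submodule.sum_mem _ fun i _ => Submodule.smul_mem _ _ (coord_mul_mem hp i)

theorem radial_mul_mem {n : ℕ} {p : E d → ℝ} (hp : p ∈ polyDegLT d n) (r : ℝ) :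
    (fun x => (r ^ 2 - ‖x‖ ^ 2) * p x) ∈ polyDegLT d (n + 2) := by
  have h : (fun x => (r ^ 2 - ‖x‖ ^ 2) * p x) =
      r ^ 2 • p - ∑ i : Fin d, fun x : E d => x i * (x i * p x) := by
    funext x
    simp only [Pi.sub_apply, Finset.sum_apply, Pi.smul_apply, smul_eq_mul, sub_mul,
      EuclideanSpace.real_norm_sq_eq, Finset.sum_mul]
    congr 1
    exact Finset.sum_congr rfl fun i _ => by ring
  rw [h]
  exact Submodule.sub_mem _ (Submodule.smul_mem _ _ (polyDegLT_mono (by omega) hp))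
    (Submodule.sum_mem _ fun i _ => coord_mul_mem (coord_mul_mem hp i) i)

theorem mul_coordMonomial_mem {n : ℕ} {p : E d → ℝ} (hp : p ∈ polyDegLT d n)
    (L : List (Fin d)) : (fun x => p x * coordMonomial L x) ∈ polyDegLT d (n + L.length) := by
  induction L with
  | nil => simpa [coordMonomial_nil] using hp
  | cons i L ih =>
    have e : (fun x => p x * coordMonomial (i :: L) x) =
        fun x => x i * (p x * coordMonomial L x) := by
      funext x
      rw [coordMonomial_cons]
      ring
    rw [e]
    exact coord_mul_mem ih i

theorem mul_mem_polyDegLT {m n : ℕ} {p q : E d → ℝ} (hp : p ∈ polyDegLT d m)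
    (hq : q ∈ polyDegLT d n) : p * q ∈ polyDegLT d (m + n) := by
  refine polyDegLT_induction (P := fun q => p * q ∈ polyDegLT d (m + n))
    (fun L hL => ?_) ?_ (fun q₁ _ q₂ _ h1 h2 => ?_) (fun c q _ h => ?_) hq
  · exact polyDegLT_mono (by omega) (mul_coordMonomial_mem hp L)
  · simp
  · rw [mul_add]
    exact Submodule.add_mem _ h1 h2
  · rw [mul_smul_comm]
    exact Submodule.smul_mem _ c h

theorem coord_dunklReflect (α x : E d) (i : Fin d) :
    dunklReflect α x i = ⟪dunklReflect α (EuclideanSpace.single i 1), x⟫ := by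
  rw [← inner_dunklReflect_right, EuclideanSpace.inner_single_left]
  simp

theorem coordMonomial_comp_dunklReflect_mem (α : E d) (L : List (Fin d)) :
    (fun x => coordMonomial L (dunklReflect α x)) ∈ polyDegLT d (L.length + 1) := by
  induction L with
  | nil =>
    have := coordMonomial_mem (L := ([] : List (Fin d))) (n := 1) (by simp)
    simpa [coordMonomial_nil] using this
  | cons i L ih =>
    simp only [coordMonomial_cons, coord_dunklReflect α _ i]
    exact inner_mul_mem ih _

theorem fderiv_coord (i : Fin d) (x v : E d) : fderiv ℝ (fun y : E d => y i) x v = v i := by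
  have h : HasFDerivAt (fun y : E d => y i) (EuclideanSpace.proj (𝕜 := ℝ) i) x :=
    (EuclideanSpace.proj (𝕜 := ℝ) i).hasFDerivAt
  rw [h.fderiv]
  rfl

theorem secondDeriv_coord (i : Fin d) (x v : E d) :
    secondDeriv (fun y : E d => y i) x v = 0 := by
  rw [← fderiv_fderiv_const (contDiff_coord i)]
  simp [fderiv_coord]

/-- The `i`-th Dunkl operator. -/
def dunklOp (R : Finset (E d)) (k : E d → ℝ) (i : Fin d) (u : E d → ℝ) (x : E d) : ℝ :=
  fderiv ℝ u x (EuclideanSpace.single i 1) +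
    ∑ α ∈ R, k α * (α i / 2) * ((u x - u (dunklReflect α x)) / ⟪α, x⟫)

theorem coord_sub_coord_dunklReflect (α x : E d) (i : Fin d) :
    x i - dunklReflect α x i = 2 * ⟪α, x⟫ / ‖α‖ ^ 2 * α i := by
  simp [dunklReflect]

theorem dunklOp_coord_mul {R : Finset (E d)} (hR0 : ∀ α ∈ R, α ≠ 0) (k : E d → ℝ) (i j : Fin d)
    {u : E d → ℝ} (hu : ContDiff ℝ 1 u) {x : E d} (hx : x ∈ regularSet R) :
    dunklOp R k i (fun y => y j * u y) x =
      x j * dunklOp R k i u x + (EuclideanSpace.single i (1 : ℝ) : E d) j * u x +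
        ∑ α ∈ R, k α * α i * α j / ‖α‖ ^ 2 * u (dunklReflect α x) := by
  have hroot : ∀ α ∈ R, k α * (α i / 2) *
      ((x j * u x - dunklReflect α x j * u (dunklReflect α x)) / ⟪α, x⟫) =
      x j * (k α * (α i / 2) * ((u x - u (dunklReflect α x)) / ⟪α, x⟫)) +
        k α * α i * α j / ‖α‖ ^ 2 * u (dunklReflect α x) := by
    intro α hα
    have h1 : dunklReflect α x j = x j - 2 * ⟪α, x⟫ / ‖α‖ ^ 2 * α j := by
      rw [← coord_sub_coord_dunklReflect]; ring
    have h2 := hx α hα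
    have h3 : ‖α‖ ≠ 0 := norm_ne_zero_iff.2 (hR0 α hα)
    rw [h1]
    field_simp
    ring
  rw [dunklOp, Finset.sum_congr rfl hroot, Finset.sum_add_distrib, ← Finset.mul_sum, dunklOp,
    fderiv_fun_mul ((contDiff_coord j (m := 1)).differentiable one_ne_zero x)
      (hu.differentiable one_ne_zero x)]
  simp only [add_apply, smul_apply, smul_eq_mul, fderiv_coord]
  ring

theorem carreDuChamp_coord {R : Finset (E d)} (hR0 : ∀ α ∈ R, α ≠ 0) (k : E d → ℝ) (i : Fin d)
    (u : E d → ℝ) {x : E d} (hx : x ∈ regularSet R) :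
    carreDuChamp R k (fun y => y i) u x = dunklOp R k i u x := by
  rw [carreDuChamp, dunklOp]
  congr 1
  · simp [fderiv_coord]
  · refine Finset.sum_congr rfl fun α hα => ?_
    have h2 := hx α hα
    have h3 : ‖α‖ ≠ 0 := norm_ne_zero_iff.2 (hR0 α hα)
    rw [coord_sub_coord_dunklReflect]
    field_simp
    ring

theorem dunklLap_coord {R : Finset (E d)} (hR0 : ∀ α ∈ R, α ≠ 0) (k : E d → ℝ) (i : Fin d)
    {x : E d} (hx : x ∈ regularSet R) : dunklLap R k (fun y => y i) x = 0 := by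
  rw [dunklLap_eq, lap_eq_sum]
  simp only [secondDeriv_coord, Finset.sum_const_zero, zero_add, fderiv_coord]
  refine Finset.sum_eq_zero fun α hα => ?_
  have h2 := hx α hα
  have h3 : ‖α‖ ≠ 0 := norm_ne_zero_iff.2 (hR0 α hα)
  rw [coord_sub_coord_dunklReflect]
  field_simp
  ring

theorem exists_dunklOp_coordMonomial {R : Finset (E d)} (hR0 : ∀ α ∈ R, α ≠ 0) (k : E d → ℝ)
    (i : Fin d) (L : List (Fin d)) :
    ∃ q ∈ polyDegLT d L.length, ∀ x ∈ regularSet R, dunklOp R k i (coordMonomial L) x = q x := by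
  induction L with
  | nil =>
    refine ⟨0, Submodule.zero_mem _, fun x _ => ?_⟩
    simp [coordMonomial_nil, dunklOp]
  | cons j L ih =>
    obtain ⟨q, hq, h⟩ := ih
    refine ⟨(fun x => x j * q x) + ((EuclideanSpace.single i (1 : ℝ) : E d) j) • coordMonomial L +
      ∑ α ∈ R, (k α * α i * α j / ‖α‖ ^ 2) • fun x => coordMonomial L (dunklReflect α x),
      ?_, fun x hx => ?_⟩
    · exact Submodule.add_mem _ (Submodule.add_mem _ (coord_mul_mem hq j)
        (Submodule.smul_mem _ _ (coordMonomial_mem (by simp)))) (Submodule.sum_mem _ fun α _ =>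
          Submodule.smul_mem _ _ (coordMonomial_comp_dunklReflect_mem α L))
    · rw [coordMonomial_cons, dunklOp_coord_mul hR0 k i j (contDiff_coordMonomial L) hx, h x hx]
      simp only [Pi.add_apply, Pi.smul_apply, smul_eq_mul, Finset.sum_apply]

theorem exists_dunklLap_coordMonomial {R : Finset (E d)} (hR0 : ∀ α ∈ R, α ≠ 0) (k : E d → ℝ)
    (L : List (Fin d)) :
    ∃ q ∈ polyDegLT d (L.length - 1), ∀ x ∈ regularSet R,
      dunklLap R k (coordMonomial L) x = q x := by
  induction L with
  | nil =>
    refine ⟨0, Submodule.zero_mem _, fun x _ => ?_⟩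
    rw [coordMonomial_nil, dunklLap_const]
    rfl
  | cons j L ih =>
    obtain ⟨q, hq, h⟩ := ih
    obtain ⟨p, hp, h'⟩ := exists_dunklOp_coordMonomial hR0 k j L
    refine ⟨(fun x => x j * q x) + (2 : ℝ) • p, ?_, fun x hx => ?_⟩
    · refine Submodule.add_mem _ ?_ (Submodule.smul_mem _ _ (by simpa using hp))
      cases L with
      | nil =>
        have hq0 : q = 0 := by simpa [polyDegLT] using hq
        simp only [hq0, Pi.zero_apply, mul_zero]
        exact Submodule.zero_mem _
      | cons l L => simpa using coord_mul_mem hq j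
    · rw [coordMonomial_cons, dunklLap_mul R k (contDiff_coord j) (contDiff_coordMonomial L),
        dunklLap_coord hR0 k j hx, carreDuChamp_coord hR0 k j _ hx, h x hx, h' x hx]
      simp

theorem exists_dunklLap_eq_of_mem_polyDegLT {R : Finset (E d)} (hR0 : ∀ α ∈ R, α ≠ 0)
    (k : E d → ℝ) {n : ℕ} {p : E d → ℝ} (hp : p ∈ polyDegLT d n) :
    ∃ q ∈ polyDegLT d (n - 2), ∀ x ∈ regularSet R, dunklLap R k p x = q x := by
  refine polyDegLT_induction (P := fun p => ∃ q ∈ polyDegLT d (n - 2), ∀ x ∈ regularSet R,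
    dunklLap R k p x = q x) (fun L hL => ?_) ?_ (fun p₁ hp₁ p₂ hp₂ h1 h2 => ?_)
    (fun c p hp h => ?_) hp
  · obtain ⟨q, hq, h⟩ := exists_dunklLap_coordMonomial hR0 k L
    exact ⟨q, polyDegLT_mono (by omega) hq, h⟩
  · exact ⟨0, Submodule.zero_mem _, fun x _ => dunklLap_const R k 0 x⟩
  · obtain ⟨q₁, hq₁, e1⟩ := h1
    obtain ⟨q₂, hq₂, e2⟩ := h2
    refine ⟨q₁ + q₂, Submodule.add_mem _ hq₁ hq₂, fun x hx => ?_⟩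
    rw [Pi.add_apply, ← e1 x hx, ← e2 x hx]
    exact dunklLap_add R k (contDiff_of_mem_polyDegLT hp₁) (contDiff_of_mem_polyDegLT hp₂) x
  · obtain ⟨q, hq, e⟩ := h
    refine ⟨c • q, Submodule.smul_mem _ c hq, fun x hx => ?_⟩
    rw [Pi.smul_apply, ← e x hx]
    exact dunklLap_const_mul R k (contDiff_of_mem_polyDegLT hp) c x

theorem exists_polyDegLT_near {K : Set (E d)} (hK : IsCompact K) {f : E d → ℝ}
    (hf : ContinuousOn f K) {ε : ℝ} (hε : 0 < ε) :
    ∃ n, ∃ p ∈ polyDegLT d n, ∀ x ∈ K, |p x - f x| < ε := by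
  have : CompactSpace K := isCompact_iff_compactSpace.1 hK
  let A : Subalgebra ℝ C(K, ℝ) :=
    { carrier := {g | ∃ n, ∃ p ∈ polyDegLT d n, ∀ x : K, g x = p x}
      mul_mem' := by
        rintro a b ⟨m, p, hp, ha⟩ ⟨n, q, hq, hb⟩
        exact ⟨m + n, p * q, mul_mem_polyDegLT hp hq, fun x => by simp [ha, hb]⟩
      add_mem' := by
        rintro a b ⟨m, p, hp, ha⟩ ⟨n, q, hq, hb⟩
        exact ⟨m + n, p + q, Submodule.add_mem _ (polyDegLT_mono (by omega) hp)
          (polyDegLT_mono (by omega) hq), fun x => by simp [ha, hb]⟩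
      algebraMap_mem' := fun c => ⟨1, c • coordMonomial [],
        Submodule.smul_mem _ _ (coordMonomial_mem (by simp)), fun x => by
          simp [coordMonomial_nil, algebraMap_apply]⟩ }
  have hA : A.SeparatesPoints := by
    intro x y hxy
    obtain ⟨i, hi⟩ : ∃ i, (x : E d) i ≠ (y : E d) i := by
      by_contra! h
      exact hxy (Subtype.ext (PiLp.ext h))
    refine ⟨_, ⟨⟨fun z : K => (z : E d) i,
      (contDiff_coord i (m := 0)).continuous.comp continuous_subtype_val⟩, ?_, rfl⟩, hi⟩
    refine ⟨2, coordMonomial [i], coordMonomial_mem (by simp), fun z => ?_⟩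
    simp [coordMonomial]
  obtain ⟨⟨g, n, p, hp, hg⟩, h⟩ :=
    ContinuousMap.exists_mem_subalgebra_near_continuous_of_separatesPoints A hA
      (K.domRestrict f) hf.domRestrict ε hε
  exact ⟨n, p, hp, fun x hx => by rw [← hg ⟨x, hx⟩]; exact h ⟨x, hx⟩⟩

end Polynomials

section Fischer

variable {d : ℕ}

theorem contDunklLap_eq_zero_of_dunklLap_eq_zero {R : Finset (E d)} (hR0 : ∀ α ∈ R, α ≠ 0)
    (k : E d → ℝ) {u : E d → ℝ} (hu : ContDiff ℝ 2 u)
    (hL : ∀ x ∈ regularSet R, dunklLap R k u x = 0) (x : E d) : contDunklLap R k u x = 0 :=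
  congrFun ((continuous_contDunklLap R k hu).ext_on (dense_regularSet hR0) continuous_zero
    fun y hy => (contDunklLap_eq_dunklLap hR0 k hu hy).trans (hL y hy)) x

theorem dunklLap_sub (R : Finset (E d)) (k : E d → ℝ) {u v : E d → ℝ} (hu : ContDiff ℝ 2 u)
    (hv : ContDiff ℝ 2 v) (x : E d) :
    dunklLap R k (fun y => u y - v y) x = dunklLap R k u x - dunklLap R k v x := by
  have h : (fun y => u y - v y) = fun y => u y + (-1) * v y := by
    funext y
    ring
  rw [h, dunklLap_add R k hu (contDiff_const.mul hv), dunklLap_const_mul R k hv]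
  ring

theorem abs_le_of_dunklLap_eq_zero (hd : 1 ≤ d) {R : Finset (E d)} (hR0 : ∀ α ∈ R, α ≠ 0)
    {k : E d → ℝ} (hk : ∀ α ∈ R, 0 < k α) {r : ℝ} (hr : 0 < r) {u : E d → ℝ}
    (hu : ContDiff ℝ 2 u) (hL : ∀ x ∈ regularSet R, dunklLap R k u x = 0) {M : ℝ}
    (hM : ∀ x ∈ Metric.sphere (0 : E d) r, |u x| ≤ M) :
    ∀ x ∈ Metric.closedBall (0 : E d) r, |u x| ≤ M := by
  intro x hx
  have hL' : ∀ x ∈ regularSet R, dunklLap R k (fun y => (-1) * u y) x = 0 := fun x hx => by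
    rw [dunklLap_const_mul R k hu, hL x hx, mul_zero]
  refine abs_le'.2 ⟨le_of_contDunklLap_eq_zero hd hR0 hk hr hu
    (contDunklLap_eq_zero_of_dunklLap_eq_zero hR0 k hu hL)
    (fun y hy => (le_abs_self _).trans (hM y hy)) x hx, ?_⟩
  rw [← neg_one_mul]
  exact le_of_contDunklLap_eq_zero hd hR0 hk hr (contDiff_const.mul hu)
    (contDunklLap_eq_zero_of_dunklLap_eq_zero hR0 k (contDiff_const.mul hu) hL')
    (fun y hy => by rw [neg_one_mul]; exact (neg_le_abs _).trans (hM y hy)) x hx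

theorem contDiff_radial (r : ℝ) {n : WithTop ℕ∞} :
    ContDiff ℝ n fun x : E d => r ^ 2 - ‖x‖ ^ 2 :=
  contDiff_const.sub contDiff_norm_sq'

theorem eq_zero_of_dunklLap_radial_mul_eq_zero (hd : 1 ≤ d) {R : Finset (E d)}
    (hR0 : ∀ α ∈ R, α ≠ 0) {k : E d → ℝ} (hk : ∀ α ∈ R, 0 < k α) {r : ℝ} (hr : 0 < r) {n : ℕ}
    {q : E d → ℝ} (hq : q ∈ polyDegLT d n)
    (hL : ∀ x ∈ regularSet R, dunklLap R k (fun x => (r ^ 2 - ‖x‖ ^ 2) * q x) x = 0) : q = 0 := by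
  have hball : ∀ x ∈ Metric.ball (0 : E d) r, q x = 0 := by
    intro x hx
    have h := abs_le_of_dunklLap_eq_zero hd hR0 hk hr
      ((contDiff_radial r).mul (contDiff_of_mem_polyDegLT hq)) hL (M := 0)
      (fun y hy => by simp [mem_sphere_zero_iff_norm.1 hy]) x (Metric.ball_subset_closedBall hx)
    have hx' : ‖x‖ < r := mem_ball_zero_iff.1 hx
    have hne : r ^ 2 - ‖x‖ ^ 2 ≠ 0 := by nlinarith [norm_nonneg x]
    exact (mul_eq_zero.1 (abs_nonpos_iff.1 h)).resolve_left hne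
  have han : AnalyticOnNhd ℝ q Set.univ := fun x _ =>
    (contDiff_of_mem_polyDegLT hq (m := ⊤)).contDiffAt.analyticAt
  refine han.eq_of_eventuallyEq (z₀ := 0) (fun x _ => analyticAt_const) ?_
  filter_upwards [Metric.ball_mem_nhds (0 : E d) hr] with x hx using hball x hx

theorem exists_dunklLap_radial_mul_eq (hd : 1 ≤ d) {R : Finset (E d)}
    (hR0 : ∀ α ∈ R, α ≠ 0) {k : E d → ℝ} (hk : ∀ α ∈ R, 0 < k α) {r : ℝ} (hr : 0 < r) {n : ℕ}
    {g : E d → ℝ} (hg : g ∈ polyDegLT d n) :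
    ∃ q ∈ polyDegLT d n, ∀ x ∈ regularSet R,
      dunklLap R k (fun x => (r ^ 2 - ‖x‖ ^ 2) * q x) x = g x := by
  have hsm : ∀ q : polyDegLT d n, ContDiff ℝ 2 fun x => (r ^ 2 - ‖x‖ ^ 2) * (q : E d → ℝ) x :=
    fun q => (contDiff_radial r).mul (contDiff_of_mem_polyDegLT q.2)
  let res : polyDegLT d n →ₗ[ℝ] (regularSet R → ℝ) :=
    { toFun := fun q x => (q : E d → ℝ) x
      map_add' := fun _ _ => rfl
      map_smul' := fun _ _ => rfl }
  let Ψ : polyDegLT d n →ₗ[ℝ] (regularSet R → ℝ) :=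
    { toFun := fun q x => dunklLap R k (fun x => (r ^ 2 - ‖x‖ ^ 2) * (q : E d → ℝ) x) x
      map_add' := fun p q => by
        funext x
        simp only [Submodule.coe_add, Pi.add_apply, mul_add]
        exact dunklLap_add R k (hsm p) (hsm q) x
      map_smul' := fun c p => by
        funext x
        simp only [Submodule.coe_smul, Pi.smul_apply, smul_eq_mul, RingHom.id_apply,
          mul_left_comm _ c]
        exact dunklLap_const_mul R k (hsm p) c x }
  have hle : LinearMap.range Ψ ≤ LinearMap.range res := by
    rintro _ ⟨q, rfl⟩
    obtain ⟨p, hp, h⟩ := exists_dunklLap_eq_of_mem_polyDegLT hR0 k (radial_mul_mem q.2 r)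
    exact ⟨⟨p, hp⟩, funext fun x => (h x x.2).symm⟩
  have hinj : Function.Injective Ψ := by
    rw [← LinearMap.ker_eq_bot, LinearMap.ker_eq_bot']
    exact fun q hq => Subtype.ext (eq_zero_of_dunklLap_radial_mul_eq_zero hd hR0 hk hr q.2
      fun x hx => congrFun hq ⟨x, hx⟩)
  have heq : LinearMap.range Ψ = LinearMap.range res :=
    Submodule.eq_of_le_of_finrank_le hle
      ((LinearMap.finrank_range_le res).trans (LinearMap.finrank_range_of_inj hinj).ge)
  obtain ⟨q, hq⟩ : res ⟨g, hg⟩ ∈ LinearMap.range Ψ := heq ▸ LinearMap.mem_range_self res _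
  exact ⟨q, q.2, fun x hx => congrFun hq ⟨x, hx⟩⟩

theorem exists_harmonic_extension_polynomial (hd : 1 ≤ d) {R : Finset (E d)}
    (hR0 : ∀ α ∈ R, α ≠ 0) {k : E d → ℝ} (hk : ∀ α ∈ R, 0 < k α) {r : ℝ} (hr : 0 < r) {n : ℕ}
    {p : E d → ℝ} (hp : p ∈ polyDegLT d n) :
    ∃ h : E d → ℝ, ContDiff ℝ 2 h ∧ (∀ x ∈ regularSet R, dunklLap R k h x = 0) ∧
      ∀ x ∈ Metric.sphere (0 : E d) r, h x = p x := by
  obtain ⟨g, hg, hgp⟩ := exists_dunklLap_eq_of_mem_polyDegLT hR0 k hp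
  obtain ⟨q, hq, hqg⟩ := exists_dunklLap_radial_mul_eq hd hR0 hk hr hg
  have hp2 : ContDiff ℝ 2 p := contDiff_of_mem_polyDegLT hp
  have hq2 : ContDiff ℝ 2 fun x => (r ^ 2 - ‖x‖ ^ 2) * q x :=
    (contDiff_radial r).mul (contDiff_of_mem_polyDegLT hq)
  refine ⟨fun x => p x - (r ^ 2 - ‖x‖ ^ 2) * q x, hp2.sub hq2, fun x hx => ?_, fun x hx => ?_⟩
  · rw [dunklLap_sub R k hp2 hq2, hgp x hx, hqg x hx, sub_self]
  · simp [mem_sphere_zero_iff_norm.1 hx]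

end Fischer

section Existence

variable {d : ℕ}

theorem isDunklHarmonic_of_tendsto {R : Finset (E d)} (hR0 : ∀ α ∈ R, α ≠ 0) {k : E d → ℝ}
    (hk : ∀ α ∈ R, 0 < k α) {r : ℝ} (hr : 0 < r) {h : E d → ℝ} {H : ℕ → E d → ℝ}
    (hh : ContinuousOn h (closure (Metric.ball (0 : E d) r))) (hH : ∀ n, Continuous (H n))
    (hharm : ∀ n, IsDunklHarmonic R k (Metric.ball 0 r) (H n))
    (hlim : ∀ x ∈ Metric.ball (0 : E d) r, Tendsto (fun n => H n x) atTop (𝓝 (h x)))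
    (hbd : ∀ n, ∀ x ∈ Metric.ball (0 : E d) r, |H n x| ≤ |h x| + 1) :
    IsDunklHarmonic R k (Metric.ball 0 r) h := by
  intro ψ hψ hc hsupp
  have hψ2 : ContDiff ℝ 2 ψ := by exact_mod_cast contDiff_infty.1 hψ 2
  have hG : Continuous fun x => contDunklLap R k ψ x * wk R k x :=
    (continuous_contDunklLap R k hψ2).mul (continuous_wk hk)
  have hball : ∀ᵐ x ∂(volume.restrict (Metric.ball (0 : E d) r)), x ∈ Metric.ball (0 : E d) r :=
    ae_restrict_mem measurableSet_ball
  rw [setIntegral_dunklLap_eq hR0 k h hψ2]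
  refine tendsto_nhds_unique (tendsto_integral_of_dominated_convergence
    (F := fun n x => H n x * (contDunklLap R k ψ x * wk R k x))
    (fun x => (|h x| + 1) * |contDunklLap R k ψ x * wk R k x|)
    (fun n => ((hH n).mul hG).aestronglyMeasurable) ?_ (fun n => ?_) ?_) ?_
  · exact ContinuousOn.integrableOn_ball_of_closure hr
      ((hh.abs.add continuousOn_const).mul hG.abs.continuousOn)
  · filter_upwards [hball] with x hx
    rw [norm_mul]
    exact mul_le_mul_of_nonneg_right (hbd n x hx) (norm_nonneg _)
  · filter_upwards [hball] with x hx using (hlim x hx).mul_const _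
  · have h0 : ∀ n, ∫ x in Metric.ball (0 : E d) r,
        H n x * (contDunklLap R k ψ x * wk R k x) = 0 := fun n => by
      rw [← setIntegral_dunklLap_eq hR0 k (H n) hψ2]
      exact hharm n ψ hψ hc hsupp
    simp only [h0]
    exact tendsto_const_nhds

theorem exists_dunkl_dirichlet_solution (hd : 1 ≤ d) {R : Finset (E d)}
    (hR0 : ∀ α ∈ R, α ≠ 0) (hRrefl : ∀ α ∈ R, ∀ β ∈ R, dunklReflect α β ∈ R) {k : E d → ℝ}
    (hk : ∀ α ∈ R, 0 < k α) (hkinv : ∀ α ∈ R, ∀ β ∈ R, k (dunklReflect α β) = k β) {r : ℝ}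
    (hr : 0 < r) {f : E d → ℝ} (hf : ContinuousOn f (Metric.sphere (0 : E d) r))
    (hf0 : ∀ x ∈ Metric.sphere (0 : E d) r, 0 ≤ f x) :
    ∃ h : E d → ℝ, ContinuousOn h (closure (Metric.ball (0 : E d) r)) ∧
      (∀ x ∈ closure (Metric.ball (0 : E d) r), 0 ≤ h x) ∧
      (∀ x ∈ Metric.sphere (0 : E d) r, h x = f x) ∧
      IsDunklHarmonic R k (Metric.ball 0 r) h := by
  set b : ℕ → ℝ := fun n => 1 / ((n : ℝ) + 1) with hb
  have hbpos : ∀ n, 0 < b n := fun n => Nat.one_div_pos_of_nat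
  have hb0 : Tendsto b atTop (𝓝 0) := tendsto_one_div_add_atTop_nhds_zero_nat
  have hbanti : ∀ m n, m ≤ n → b n ≤ b m := fun m n hmn => Nat.one_div_le_one_div hmn
  have hH : ∀ n, ∃ H : E d → ℝ, ContDiff ℝ 2 H ∧ (∀ x ∈ regularSet R, dunklLap R k H x = 0) ∧
      ∀ x ∈ Metric.sphere (0 : E d) r, |H x - f x| ≤ b n := by
    intro n
    obtain ⟨m, p, hp, hpf⟩ := exists_polyDegLT_near (isCompact_sphere (0 : E d) r) hf (hbpos n)
    obtain ⟨H, h1, h2, h3⟩ := exists_harmonic_extension_polynomial hd hR0 hk hr hp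
    exact ⟨H, h1, h2, fun x hx => by rw [h3 x hx]; exact (hpf x hx).le⟩
  choose H hH2 hHL hHf using hH
  have hdist : ∀ n m, ∀ x ∈ Metric.closedBall (0 : E d) r, |H n x - H m x| ≤ b n + b m := by
    intro n m
    refine abs_le_of_dunklLap_eq_zero hd hR0 hk hr ((hH2 n).sub (hH2 m))
      (fun x hx => ?_) (fun x hx => ?_)
    · exact (dunklLap_sub R k (hH2 n) (hH2 m) x).trans (by rw [hHL n x hx, hHL m x hx, sub_self])
    · have h1 := abs_le.1 (hHf n x hx)
      have h2 := abs_le.1 (hHf m x hx)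
      exact abs_le.2 ⟨by linarith, by linarith⟩
  have hlim : ∀ x ∈ Metric.closedBall (0 : E d) r, ∃ l, Tendsto (fun n => H n x) atTop (𝓝 l) := by
    intro x hx
    refine cauchySeq_tendsto_of_complete (cauchySeq_of_le_tendsto_0 (fun n => 2 * b n)
      (fun n m N hn hm => (hdist n m x hx).trans ?_) (by simpa using hb0.const_mul 2))
    linarith [hbanti N n hn, hbanti N m hm]
  set h : E d → ℝ := fun x => limUnder atTop fun n => H n x with hh
  have hlim' : ∀ x ∈ Metric.closedBall (0 : E d) r, Tendsto (fun n => H n x) atTop (𝓝 (h x)) :=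
    fun x hx => tendsto_nhds_limUnder (hlim x hx)
  have hdist' : ∀ n, ∀ x ∈ Metric.closedBall (0 : E d) r, |H n x - h x| ≤ b n := by
    intro n x hx
    refine le_of_tendsto_of_tendsto ((tendsto_const_nhds.sub (hlim' x hx)).abs)
      (by simpa using hb0.const_add (b n)) (Eventually.of_forall fun m => hdist n m x hx)
  have hcl : closure (Metric.ball (0 : E d) r) = Metric.closedBall 0 r := closure_ball _ hr.ne'
  have hcont : ContinuousOn h (Metric.closedBall (0 : E d) r) := by
    refine TendstoUniformlyOn.continuousOn (F := H) (p := atTop) ?_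
      (Frequently.of_forall fun n => (hH2 n).continuous.continuousOn)
    refine Metric.tendstoUniformlyOn_iff.2 fun ε hε => ?_
    filter_upwards [hb0.eventually (gt_mem_nhds hε)] with n hn x hx
    rw [dist_comm]
    exact (hdist' n x hx).trans_lt hn
  have hbdry : ∀ x ∈ Metric.sphere (0 : E d) r, h x = f x := fun x hx =>
    tendsto_nhds_unique (hlim' x (Metric.sphere_subset_closedBall hx))
      (tendsto_iff_norm_sub_tendsto_zero.2 (squeeze_zero (fun _ => norm_nonneg _)
        (fun n => hHf n x hx) hb0))
  refine ⟨h, hcl ▸ hcont, ?_, hbdry, ?_⟩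
  · rw [hcl]
    intro x hx
    have hneg : ∀ n, -b n ≤ H n x := by
      intro n
      have hL' : ∀ x ∈ regularSet R, dunklLap R k (fun y => (-1) * H n y) x = 0 := fun x hx => by
        rw [dunklLap_const_mul R k (hH2 n), hHL n x hx, mul_zero]
      have := le_of_contDunklLap_eq_zero hd hR0 hk hr (contDiff_const.mul (hH2 n))
        (contDunklLap_eq_zero_of_dunklLap_eq_zero hR0 k (contDiff_const.mul (hH2 n)) hL')
        (M := b n) (fun y hy => by linarith [(abs_le.1 (hHf n y hy)).1, hf0 y hy]) x hx
      linarith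
    exact le_of_tendsto_of_tendsto' (by simpa using hb0.neg) (hlim' x hx) hneg
  · refine isDunklHarmonic_of_tendsto hR0 hk hr (hcl ▸ hcont) (fun n => (hH2 n).continuous)
      (fun n => isDunklHarmonic_of_contDunklLap_eq_zero hR0 hRrefl hk hkinv hr (hH2 n)
        (contDunklLap_eq_zero_of_dunklLap_eq_zero hR0 k (hH2 n) (hHL n)))
      (fun x hx => hlim' x (Metric.ball_subset_closedBall hx)) (fun n x hx => ?_)
    have h1 := hdist' n x (Metric.ball_subset_closedBall hx)
    have h2 : b n ≤ 1 := (hbanti 0 n (Nat.zero_le n)).trans (by simp [hb])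
    calc |H n x| ≤ |h x| + |H n x - h x| := by
          simpa using abs_add_le (h x) (H n x - h x)
      _ ≤ |h x| + 1 := by linarith

end Existence

section Composition

variable {d : ℕ}

theorem fderiv_comp_apply_eq {θ : ℝ → ℝ} (hθ : Differentiable ℝ θ) {u : E d → ℝ}
    (hu : Differentiable ℝ u) (x v : E d) :
    fderiv ℝ (fun y => θ (u y)) x v = deriv θ (u x) * fderiv ℝ u x v := by
  have h : HasFDerivAt (fun y => θ (u y)) (deriv θ (u x) • fderiv ℝ u x) x :=
    (hθ (u x)).hasDerivAt.comp_hasFDerivAt x (hu x).hasFDerivAt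
  rw [h.fderiv]
  rfl

theorem secondDeriv_comp {θ : ℝ → ℝ} (hθ : ContDiff ℝ 2 θ) {u : E d → ℝ} (hu : ContDiff ℝ 2 u)
    (x v : E d) :
    secondDeriv (fun y => θ (u y)) x v =
      deriv (deriv θ) (u x) * fderiv ℝ u x v ^ 2 + deriv θ (u x) * secondDeriv u x v := by
  have hθ1 : ContDiff ℝ 1 (deriv θ) := ContDiff.iterate_deriv' 1 1 hθ
  have hθ' : Differentiable ℝ (deriv θ) := hθ1.differentiable one_ne_zero
  have hu1 : Differentiable ℝ u := hu.differentiable two_ne_zero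
  have hc : ContDiff ℝ 2 fun y => θ (u y) := hθ.comp hu
  rw [← fderiv_fderiv_const hc, ← fderiv_fderiv_const hu]
  have hc1 : DifferentiableAt ℝ (fun y => deriv θ (u y)) x := (hθ'.comp hu1) x
  simp only [fderiv_comp_apply_eq (hθ.differentiable two_ne_zero) hu1]
  rw [fderiv_fun_mul hc1
    ((contDiff_fderiv_const hu v).differentiable one_ne_zero x)]
  simp only [add_apply, smul_apply, smul_eq_mul, fderiv_comp_apply_eq hθ' hu1]
  ring

theorem dunklLap_comp (R : Finset (E d)) (k : E d → ℝ) {θ : ℝ → ℝ} (hθ : ContDiff ℝ 2 θ)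
    {u : E d → ℝ} (hu : ContDiff ℝ 2 u) {x : E d} (h : ∀ α ∈ R, u (dunklReflect α x) = u x) :
    dunklLap R k (fun y => θ (u y)) x =
      deriv (deriv θ) (u x) * ∑ i, fderiv ℝ u x (EuclideanSpace.single i 1) ^ 2 +
        deriv θ (u x) * dunklLap R k u x := by
  simp only [dunklLap_eq, lap_eq_sum, secondDeriv_comp hθ hu,
    fderiv_comp_apply_eq (hθ.differentiable two_ne_zero) (hu.differentiable two_ne_zero),
    Finset.sum_add_distrib, mul_add, Finset.mul_sum, add_assoc]
  congr 2
  refine Finset.sum_congr rfl fun α hα => ?_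
  rw [h α hα]
  simp
  ring

theorem dunklLap_comp_mul (R : Finset (E d)) (k : E d → ℝ) {θ : ℝ → ℝ} (hθ : ContDiff ℝ 2 θ)
    {u q : E d → ℝ} (hu : ContDiff ℝ 2 u) (hq : ContDiff ℝ 2 q)
    (h : ∀ α ∈ R, ∀ x, u (dunklReflect α x) = u x) (x : E d) :
    dunklLap R k (fun y => θ (u y) * q y) x =
      θ (u x) * dunklLap R k q x +
        deriv θ (u x) * (q x * dunklLap R k u x +
          2 * ∑ i, fderiv ℝ u x (EuclideanSpace.single i 1) *
            fderiv ℝ q x (EuclideanSpace.single i 1)) +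
        deriv (deriv θ) (u x) *
          (q x * ∑ i, fderiv ℝ u x (EuclideanSpace.single i 1) ^ 2) := by
  have hc : ContDiff ℝ 2 fun y => θ (u y) := hθ.comp hu
  rw [dunklLap_mul R k hc hq,
    dunklLap_comp R k hθ hu fun α hα => h α hα x,
    carreDuChamp_of_invariant k q fun α hα => congrArg θ (h α hα x)]
  simp only [fderiv_comp_apply_eq (hθ.differentiable two_ne_zero)
    (hu.differentiable two_ne_zero), mul_assoc, ← Finset.mul_sum]
  ring

end Composition

section Cutoff

/-- A smooth function that vanishes on `(-∞, 1]` and is the identity on `[2, ∞)`. -/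
def smoothTruncation (s : ℝ) : ℝ := s * smoothTransition (s - 1)

theorem contDiff_smoothTruncation {n : ℕ∞} : ContDiff ℝ n smoothTruncation :=
  contDiff_id.mul (smoothTransition.contDiff.comp (contDiff_id.sub contDiff_const))

theorem smoothTruncation_of_le {s : ℝ} (hs : s ≤ 1) : smoothTruncation s = 0 := by
  rw [smoothTruncation, smoothTransition.zero_of_nonpos (by linarith), mul_zero]

theorem smoothTruncation_of_ge {s : ℝ} (hs : 2 ≤ s) : smoothTruncation s = s := by
  rw [smoothTruncation, smoothTransition.one_of_one_le (by linarith), mul_one]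

theorem abs_smoothTruncation_le (s : ℝ) : |smoothTruncation s| ≤ |s| := by
  rw [smoothTruncation, abs_mul, abs_of_nonneg (smoothTransition.nonneg _)]
  exact mul_le_of_le_one_right (abs_nonneg _) (smoothTransition.le_one _)

theorem deriv_smoothTruncation_of_lt {s : ℝ} (hs : s < 1) : deriv smoothTruncation s = 0 := by
  have h : smoothTruncation =ᶠ[𝓝 s] fun _ => 0 := by
    filter_upwards [gt_mem_nhds hs] with t ht using smoothTruncation_of_le ht.le
  rw [h.deriv_eq, deriv_const]

theorem deriv_smoothTruncation_of_gt {s : ℝ} (hs : 2 < s) : deriv smoothTruncation s = 1 := by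
  have h : smoothTruncation =ᶠ[𝓝 s] id := by
    filter_upwards [lt_mem_nhds hs] with t ht using smoothTruncation_of_ge ht.le
  rw [h.deriv_eq, deriv_id]

theorem deriv_deriv_smoothTruncation_eq_zero {s : ℝ} (hs : s < 1 ∨ 2 < s) :
    deriv (deriv smoothTruncation) s = 0 := by
  rcases hs with hs | hs
  · have h : deriv smoothTruncation =ᶠ[𝓝 s] fun _ => 0 := by
      filter_upwards [gt_mem_nhds hs] with t ht using deriv_smoothTruncation_of_lt ht
    rw [h.deriv_eq, deriv_const]
  · have h : deriv smoothTruncation =ᶠ[𝓝 s] fun _ => 1 := by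
      filter_upwards [lt_mem_nhds hs] with t ht using deriv_smoothTruncation_of_gt ht
    rw [h.deriv_eq, deriv_const]

theorem exists_bound_deriv_smoothTruncation :
    ∃ C, 0 ≤ C ∧ ∀ s, |deriv smoothTruncation s| ≤ C ∧ |deriv (deriv smoothTruncation) s| ≤ C := by
  have h1 : Continuous (deriv smoothTruncation) :=
    (contDiff_smoothTruncation (n := 1)).continuous_deriv le_rfl
  have h2 : Continuous (deriv (deriv smoothTruncation)) :=
    (ContDiff.iterate_deriv' 1 1 (contDiff_smoothTruncation (n := 2))).continuous_deriv le_rfl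
  obtain ⟨C₁, hC₁⟩ := (isCompact_Icc (a := (1 : ℝ)) (b := 2)).exists_bound_of_continuousOn
    h1.continuousOn
  obtain ⟨C₂, hC₂⟩ := (isCompact_Icc (a := (1 : ℝ)) (b := 2)).exists_bound_of_continuousOn
    h2.continuousOn
  have hC : 0 ≤ max 1 (max C₁ C₂) := zero_le_one.trans (le_max_left _ _)
  refine ⟨max 1 (max C₁ C₂), hC, fun s => ?_⟩
  rcases lt_or_ge s 1 with hs | hs
  · rw [deriv_smoothTruncation_of_lt hs, deriv_deriv_smoothTruncation_eq_zero (Or.inl hs),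
      abs_zero]
    exact ⟨hC, hC⟩
  rcases lt_or_ge 2 s with hs' | hs'
  · rw [deriv_smoothTruncation_of_gt hs', deriv_deriv_smoothTruncation_eq_zero (Or.inr hs'),
      abs_zero, abs_one]
    exact ⟨le_max_left _ _, hC⟩
  · exact ⟨(hC₁ s ⟨hs, hs'⟩).trans ((le_max_left _ _).trans (le_max_right _ _)),
      (hC₂ s ⟨hs, hs'⟩).trans ((le_max_right _ _).trans (le_max_right _ _))⟩

/-- The rescaled truncation, which vanishes on `(-∞, δ]` and is the identity on `[2δ, ∞)`. -/
def scaledTruncation (δ s : ℝ) : ℝ := δ * smoothTruncation (δ⁻¹ * s)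

theorem contDiff_scaledTruncation (δ : ℝ) {n : ℕ∞} : ContDiff ℝ n (scaledTruncation δ) :=
  contDiff_const.mul (contDiff_smoothTruncation.comp (contDiff_const.mul contDiff_id))

theorem deriv_scaledTruncation {δ : ℝ} (hδ : 0 < δ) :
    deriv (scaledTruncation δ) = fun s => deriv smoothTruncation (δ⁻¹ * s) := by
  funext s
  have h : scaledTruncation δ = fun s => δ * smoothTruncation (δ⁻¹ * s) := rfl
  rw [h, deriv_const_mul_field, deriv_comp_mul_left, smul_eq_mul, mul_inv_cancel_left₀ hδ.ne']

theorem deriv_deriv_scaledTruncation {δ : ℝ} (hδ : 0 < δ) (s : ℝ) :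
    deriv (deriv (scaledTruncation δ)) s =
      δ⁻¹ * deriv (deriv smoothTruncation) (δ⁻¹ * s) := by
  rw [deriv_scaledTruncation hδ, deriv_comp_mul_left, smul_eq_mul]

theorem scaledTruncation_of_le {δ s : ℝ} (hδ : 0 < δ) (hs : s ≤ δ) : scaledTruncation δ s = 0 := by
  rw [scaledTruncation, smoothTruncation_of_le, mul_zero]
  rwa [inv_mul_le_iff₀ hδ, mul_one]

theorem scaledTruncation_of_ge {δ s : ℝ} (hδ : 0 < δ) (hs : 2 * δ ≤ s) :
    scaledTruncation δ s = s := by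
  rw [scaledTruncation, smoothTruncation_of_ge, mul_inv_cancel_left₀ hδ.ne']
  rwa [le_inv_mul_iff₀ hδ, mul_comm]

theorem deriv_scaledTruncation_of_gt {δ s : ℝ} (hδ : 0 < δ) (hs : 2 * δ < s) :
    deriv (scaledTruncation δ) s = 1 := by
  rw [deriv_scaledTruncation hδ]
  exact deriv_smoothTruncation_of_gt (by rwa [lt_inv_mul_iff₀ hδ, mul_comm])

theorem deriv_deriv_scaledTruncation_of_gt {δ s : ℝ} (hδ : 0 < δ) (hs : 2 * δ < s) :
    deriv (deriv (scaledTruncation δ)) s = 0 := by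
  rw [deriv_deriv_scaledTruncation hδ, deriv_deriv_smoothTruncation_eq_zero (Or.inr _), mul_zero]
  rwa [lt_inv_mul_iff₀ hδ, mul_comm]

theorem abs_scaledTruncation_le {δ : ℝ} (hδ : 0 < δ) (s : ℝ) : |scaledTruncation δ s| ≤ |s| := by
  calc |scaledTruncation δ s| = δ * |smoothTruncation (δ⁻¹ * s)| := by
        rw [scaledTruncation, abs_mul, abs_of_pos hδ]
    _ ≤ δ * |δ⁻¹ * s| := mul_le_mul_of_nonneg_left (abs_smoothTruncation_le _) hδ.le
    _ = |s| := by rw [abs_mul, abs_of_pos (inv_pos.2 hδ), mul_inv_cancel_left₀ hδ.ne']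

end Cutoff

section BoundaryLayer

variable {d : ℕ}

theorem real_volume_ball {s : ℝ} (hs : 0 < s) :
    volume.real (Metric.ball (0 : E d) s) = s ^ d * volume.real (Metric.ball (0 : E d) 1) := by
  rw [measureReal_def, Measure.addHaar_ball_of_pos _ _ hs, ENNReal.toReal_mul,
    finrank_euclideanSpace_fin, ENNReal.toReal_ofReal (pow_nonneg hs.le _), measureReal_def]

theorem real_volume_shell_le {r t : ℝ} (hr : 0 < r) (ht0 : 0 < t) (ht1 : t < 1) :
    volume.real (Metric.ball (0 : E d) r \ Metric.ball (0 : E d) (r * (1 - t))) ≤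
      r ^ d * volume.real (Metric.ball (0 : E d) 1) * (d * t) := by
  have hs : 0 < r * (1 - t) := mul_pos hr (by linarith)
  have hsub : Metric.ball (0 : E d) (r * (1 - t)) ⊆ Metric.ball (0 : E d) r :=
    Metric.ball_subset_ball (by nlinarith)
  have hbern : 1 - d * t ≤ (1 - t) ^ d := by
    have := one_add_mul_le_pow (a := -t) (by linarith) d
    simpa [sub_eq_add_neg] using this
  rw [measureReal_sdiff hsub measurableSet_ball, real_volume_ball hr, real_volume_ball hs, mul_pow]
  have hV : 0 ≤ r ^ d * volume.real (Metric.ball (0 : E d) 1) := by positivity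
  nlinarith

theorem exists_shell_abs_le {U : E d → ℝ} {r : ℝ} (hr : 0 < r)
    (hU : ContinuousOn U (Metric.closedBall (0 : E d) r))
    (hU0 : ∀ x ∈ Metric.sphere (0 : E d) r, U x = 0) {ε : ℝ} (hε : 0 < ε) :
    ∃ t₀ > 0, ∀ t < 1, t < t₀ → ∀ x ∈ Metric.ball (0 : E d) r, r * (1 - t) ≤ ‖x‖ → |U x| ≤ ε := by
  have huc := (isCompact_closedBall (0 : E d) r).uniformContinuousOn_of_continuous hU
  obtain ⟨η, hη, h⟩ := Metric.uniformContinuousOn_iff.1 huc ε hε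
  refine ⟨η / r, div_pos hη hr, fun t ht1 ht x hx hxt => ?_⟩
  have hx' : ‖x‖ < r := mem_ball_zero_iff.1 hx
  have hx0 : 0 < ‖x‖ := (mul_pos hr (by linarith)).trans_le hxt
  have hsph : (r / ‖x‖) • x ∈ Metric.sphere (0 : E d) r := by
    rw [mem_sphere_zero_iff_norm, norm_smul, norm_of_nonneg (by positivity),
      div_mul_cancel₀ _ hx0.ne']
  have hd : dist x ((r / ‖x‖) • x) < η := by
    have h1 : x - (r / ‖x‖) • x = (1 - r / ‖x‖) • x := by rw [sub_smul, one_smul]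
    have h2 : 1 - r / ‖x‖ ≤ 0 := by
      rw [sub_nonpos, one_le_div hx0]
      exact hx'.le
    rw [dist_eq_norm, h1, norm_smul, norm_eq_abs, abs_of_nonpos h2, neg_sub, sub_mul,
      div_mul_cancel₀ _ hx0.ne', one_mul]
    have h3 : r * t < η := by rwa [mul_comm, ← lt_div_iff₀ hr]
    nlinarith
  have := h x (Metric.ball_subset_closedBall hx) _ (Metric.sphere_subset_closedBall hsph) hd
  rw [hU0 _ hsph, dist_zero_right] at this
  exact this.le

theorem tendsto_boundary_layer_integral {U : E d → ℝ} {r : ℝ} (hr : 0 < r)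
    (hU : ContinuousOn U (Metric.closedBall (0 : E d) r))
    (hU0 : ∀ x ∈ Metric.sphere (0 : E d) r, U x = 0) :
    Tendsto (fun t => ∫ x in Metric.ball (0 : E d) r,
        U x * deriv (deriv (scaledTruncation (r ^ 2 / 2 * t))) (r ^ 2 - ‖x‖ ^ 2))
      (𝓝[>] 0) (𝓝 0) := by
  obtain ⟨C, hC0, hC⟩ := exists_bound_deriv_smoothTruncation
  set V : ℝ := r ^ d * volume.real (Metric.ball (0 : E d) 1) with hV
  have hV0 : 0 ≤ V := by positivity
  set K : ℝ := C * (2 / r ^ 2) * (V * d) with hK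
  have hK0 : 0 ≤ K := by positivity
  have hbound : ∀ t ∈ Set.Ioo (0 : ℝ) 1, ∀ ε ≥ 0,
      (∀ x ∈ Metric.ball (0 : E d) r, r * (1 - t) ≤ ‖x‖ → |U x| ≤ ε) →
      ‖∫ x in Metric.ball (0 : E d) r,
        U x * deriv (deriv (scaledTruncation (r ^ 2 / 2 * t))) (r ^ 2 - ‖x‖ ^ 2)‖ ≤ ε * K := by
    intro t ht ε hε hUε
    have hδ : 0 < r ^ 2 / 2 * t := mul_pos (by positivity) ht.1
    rw [setIntegral_eq_of_subset_of_forall_sdiff_eq_zero measurableSet_ball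
      (s := Metric.ball (0 : E d) r \ Metric.ball (0 : E d) (r * (1 - t))) Set.sdiff_subset]
    · refine (norm_setIntegral_le_of_norm_le_const (C := ε * ((r ^ 2 / 2 * t)⁻¹ * C))
        ((measure_mono Set.sdiff_subset).trans_lt measure_ball_lt_top) fun x hx => ?_).trans ?_
      · rw [norm_mul, deriv_deriv_scaledTruncation hδ, norm_mul, norm_of_nonneg (inv_pos.2 hδ).le]
        refine mul_le_mul (hUε x hx.1 ?_) (mul_le_mul_of_nonneg_left (hC _).2 (inv_pos.2 hδ).le)
          (by positivity) hε
        have := hx.2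
        rwa [mem_ball_zero_iff, not_lt] at this
      · calc _ ≤ ε * ((r ^ 2 / 2 * t)⁻¹ * C) * (V * (d * t)) :=
              mul_le_mul_of_nonneg_left (real_volume_shell_le hr ht.1 ht.2)
                (mul_nonneg hε (mul_nonneg (inv_pos.2 hδ).le hC0))
          _ = ε * K := by
              have := ht.1.ne'
              rw [hK]
              field_simp
    · rintro x ⟨hx, hx'⟩
      have hxt : ‖x‖ < r * (1 - t) := by
        by_contra! h
        exact hx' ⟨hx, by rw [mem_ball_zero_iff, not_lt]; exact h⟩
      have h1 : ‖x‖ ^ 2 < (r * (1 - t)) ^ 2 := by gcongr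
      rw [deriv_deriv_scaledTruncation_of_gt hδ, mul_zero]
      have h2 : 0 < t * (1 - t) := mul_pos ht.1 (sub_pos.2 ht.2)
      nlinarith [mul_pos (pow_pos hr 2) h2]
  refine Metric.tendsto_nhds.2 fun η hη => ?_
  have hε : 0 < η / (K + 1) := by positivity
  obtain ⟨t₀, ht₀, h⟩ := exists_shell_abs_le hr hU hU0 hε
  filter_upwards [Ioo_mem_nhdsGT ht₀, Ioo_mem_nhdsGT one_pos] with t ht ht'
  rw [dist_zero_right]
  calc _ ≤ η / (K + 1) * K := hbound t ht' _ hε.le (h t ht'.2 ht.2)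
    _ < η := by
      rw [div_mul_eq_mul_div, div_lt_iff₀ (by positivity)]
      nlinarith

end BoundaryLayer

section Uniqueness

variable {d : ℕ}

theorem contDunklLap_radial_comp_mul {R : Finset (E d)} (hR0 : ∀ α ∈ R, α ≠ 0) (k : E d → ℝ)
    {θ : ℝ → ℝ} (hθ : ContDiff ℝ 2 θ) {q : E d → ℝ} (hq : ContDiff ℝ 2 q) (r : ℝ) {x : E d}
    (hx : x ∈ regularSet R) :
    dunklLap R k (fun y => θ (r ^ 2 - ‖y‖ ^ 2) * q y) x =
      θ (r ^ 2 - ‖x‖ ^ 2) * contDunklLap R k q x +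
        deriv θ (r ^ 2 - ‖x‖ ^ 2) *
          (q x * contDunklLap R k (fun y => r ^ 2 - ‖y‖ ^ 2) x +
            2 * ∑ i, fderiv ℝ (fun y : E d => r ^ 2 - ‖y‖ ^ 2) x (EuclideanSpace.single i 1) *
              fderiv ℝ q x (EuclideanSpace.single i 1)) +
        deriv (deriv θ) (r ^ 2 - ‖x‖ ^ 2) *
          (q x * ∑ i, fderiv ℝ (fun y : E d => r ^ 2 - ‖y‖ ^ 2) x
            (EuclideanSpace.single i 1) ^ 2) := by
  rw [dunklLap_comp_mul R k hθ (contDiff_radial r) hq (fun α _ y => by rw [norm_dunklReflect]),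
    contDunklLap_eq_dunklLap hR0 k hq hx, contDunklLap_eq_dunklLap hR0 k (contDiff_radial r) hx]

theorem integral_mul_dunklLap_radial_mul_eq_zero {R : Finset (E d)} (hR0 : ∀ α ∈ R, α ≠ 0)
    {k : E d → ℝ} (hk : ∀ α ∈ R, 0 < k α) {r : ℝ} (hr : 0 < r) {u : E d → ℝ}
    (hu : ContinuousOn u (closure (Metric.ball (0 : E d) r)))
    (hu0 : ∀ x ∈ Metric.sphere (0 : E d) r, u x = 0)
    (hharm : IsDunklHarmonic R k (Metric.ball 0 r) u) {q : E d → ℝ}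
    (hq : ContDiff ℝ (⊤ : ℕ∞) q) :
    ∫ x in Metric.ball (0 : E d) r,
      u x * dunklLap R k (fun y => (r ^ 2 - ‖y‖ ^ 2) * q y) x * wk R k x = 0 := by
  have hq2 : ContDiff ℝ 2 q := by exact_mod_cast contDiff_infty.1 hq 2
  set ρ : E d → ℝ := fun y => r ^ 2 - ‖y‖ ^ 2 with hρ
  have hρ2 : ContDiff ℝ 2 ρ := contDiff_radial r
  set A : E d → ℝ := contDunklLap R k q with hA
  set B : E d → ℝ := fun x => q x * contDunklLap R k ρ x +
    2 * ∑ i, fderiv ℝ ρ x (EuclideanSpace.single i 1) *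
      fderiv ℝ q x (EuclideanSpace.single i 1) with hB
  set D : E d → ℝ := fun x => q x * ∑ i, fderiv ℝ ρ x (EuclideanSpace.single i 1) ^ 2 with hD
  have hAc : Continuous A := continuous_contDunklLap R k hq2
  have hBc : Continuous B :=
    (hq2.continuous.mul (continuous_contDunklLap R k hρ2)).add (continuous_const.mul
      (continuous_finsetSum _ fun i _ =>
        (continuous_fderiv_const hρ2 _).mul (continuous_fderiv_const hq2 _)))
  have hDc : Continuous D :=
    hq2.continuous.mul (continuous_finsetSum _ fun i _ => (continuous_fderiv_const hρ2 _).pow 2)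
  have hwc : Continuous (wk R k) := continuous_wk hk
  have hρc : Continuous ρ := hρ2.continuous
  obtain ⟨C, hC0, hC⟩ := exists_bound_deriv_smoothTruncation
  set θ : ℝ → ℝ → ℝ := fun t => scaledTruncation (r ^ 2 / 2 * t) with hθ
  have hθ2 : ∀ t, ContDiff ℝ 2 (θ t) := fun t => contDiff_scaledTruncation (n := 2) _
  have hθ1 : ∀ t, ContDiff ℝ 1 (deriv (θ t)) := fun t => ContDiff.iterate_deriv' 1 1 (hθ2 t)
  have hδ : ∀ t > 0, 0 < r ^ 2 / 2 * t := fun t ht => mul_pos (by positivity) ht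
  have hint : ∀ {g : E d → ℝ}, Continuous g →
      IntegrableOn (fun x => u x * g x) (Metric.ball (0 : E d) r) := fun hg =>
    ContinuousOn.integrableOn_ball_of_closure hr (hu.mul hg.continuousOn)
  set F : ℝ → E d → ℝ := fun t x =>
    u x * ((θ t (ρ x) * A x + deriv (θ t) (ρ x) * B x) * wk R k x) with hF
  have hFint : ∀ t, IntegrableOn (F t) (Metric.ball (0 : E d) r) := fun t =>
    hint (((((hθ2 t).continuous.comp hρc).mul hAc).add
      (((hθ1 t).continuous.comp hρc).mul hBc)).mul hwc)
  set S : ℝ → E d → ℝ := fun t x => (u x * (D x * wk R k x)) * deriv (deriv (θ t)) (ρ x) with hS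
  have hSint : ∀ t, IntegrableOn (S t) (Metric.ball (0 : E d) r) := fun t => by
    have h : Continuous fun x => (D x * wk R k x) * deriv (deriv (θ t)) (ρ x) :=
      (hDc.mul hwc).mul (((hθ1 t).continuous_deriv le_rfl).comp hρc)
    simpa only [hS, mul_assoc] using hint h
  have hpos : ∀ x ∈ Metric.ball (0 : E d) r, 0 < ρ x := fun x hx => by
    have := mem_ball_zero_iff.1 hx
    simp only [hρ]
    nlinarith [norm_nonneg x]
  have hFS : ∀ t > 0, ∫ x in Metric.ball (0 : E d) r, F t x =
      -∫ x in Metric.ball (0 : E d) r, S t x := by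
    intro t ht
    rw [eq_neg_iff_add_eq_zero, ← integral_add (hFint t) (hSint t)]
    have hψ : ContDiff ℝ (⊤ : ℕ∞) fun x => θ t (ρ x) * q x :=
      ((contDiff_scaledTruncation _).comp (contDiff_radial r)).mul hq
    have hsub : tsupport (fun x => θ t (ρ x) * q x) ⊆ {x | r ^ 2 / 2 * t ≤ ρ x} := by
      refine closure_minimal (fun x hx => ?_) (isClosed_le continuous_const hρc)
      by_contra h
      exact hx (by simp only [hθ, scaledTruncation_of_le (hδ t ht) (not_le.1 h).le, zero_mul])
    have hball : {x | r ^ 2 / 2 * t ≤ ρ x} ⊆ Metric.ball (0 : E d) r := fun x hx => by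
      have h1 : 0 < r ^ 2 - ‖x‖ ^ 2 := (hδ t ht).trans_le hx
      rw [mem_ball_zero_iff]
      nlinarith [norm_nonneg x]
    have hcomp : HasCompactSupport fun x => θ t (ρ x) * q x :=
      HasCompactSupport.of_support_subset_isCompact (isCompact_closedBall (0 : E d) r)
        ((subset_tsupport _).trans (hsub.trans (hball.trans Metric.ball_subset_closedBall)))
    rw [← hharm _ hψ hcomp (hsub.trans hball)]
    refine integral_congr_ae ?_
    filter_upwards [ae_restrict_of_ae (ae_mem_regularSet hR0)] with x hx
    rw [contDunklLap_radial_comp_mul hR0 k (hθ2 t) hq2 r hx]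
    simp only [hF, hS, hB, hD, hA, hρ]
    ring
  have hSlim : Tendsto (fun t => ∫ x in Metric.ball (0 : E d) r, S t x) (𝓝[>] 0) (𝓝 0) := by
    refine tendsto_boundary_layer_integral hr ?_ fun x hx => by rw [hu0 x hx, zero_mul]
    rw [← closure_ball _ hr.ne']
    exact hu.mul (hDc.mul hwc).continuousOn
  have hlim0 : Tendsto (fun t => ∫ x in Metric.ball (0 : E d) r, F t x) (𝓝[>] 0) (𝓝 0) := by
    have h := hSlim.neg
    rw [neg_zero] at h
    refine h.congr' ?_
    filter_upwards [self_mem_nhdsWithin] with t ht using (hFS t ht).symm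
  have hFlim : Tendsto (fun t => ∫ x in Metric.ball (0 : E d) r, F t x) (𝓝[>] 0)
      (𝓝 (∫ x in Metric.ball (0 : E d) r, u x * ((ρ x * A x + B x) * wk R k x))) := by
    refine tendsto_integral_filter_of_dominated_convergence
      (fun x => |u x| * ((|ρ x| * |A x| + C * |B x|) * wk R k x))
      (Eventually.of_forall fun t => (hFint t).aestronglyMeasurable) ?_ ?_ ?_
    · filter_upwards [self_mem_nhdsWithin] with t ht
      refine Eventually.of_forall fun x => ?_
      rw [norm_mul, norm_mul, norm_of_nonneg (wk_nonneg R k x)]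
      refine mul_le_mul_of_nonneg_left (mul_le_mul_of_nonneg_right ?_ (wk_nonneg R k x))
        (abs_nonneg _)
      refine (norm_add_le _ _).trans (add_le_add ?_ ?_)
      · rw [norm_mul]
        exact mul_le_mul_of_nonneg_right (abs_scaledTruncation_le (hδ t ht) _) (abs_nonneg _)
      · rw [norm_mul]
        simp only [hθ, deriv_scaledTruncation (hδ t ht)]
        exact mul_le_mul_of_nonneg_right (hC _).1 (abs_nonneg _)
    · exact ContinuousOn.integrableOn_ball_of_closure hr (hu.abs.mul
        (((hρc.abs.mul hAc.abs).add (continuous_const.mul hBc.abs)).mul hwc).continuousOn)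
    · filter_upwards [ae_restrict_mem measurableSet_ball] with x hx
      refine tendsto_const_nhds.congr' ?_
      have ht0 : 0 < ρ x / r ^ 2 := div_pos (hpos x hx) (by positivity)
      filter_upwards [Ioo_mem_nhdsGT ht0] with t ht
      have h : 2 * (r ^ 2 / 2 * t) < ρ x := by
        have := (lt_div_iff₀ (by positivity)).1 ht.2
        linarith
      simp only [hF, hθ, scaledTruncation_of_ge (hδ t ht.1) h.le,
        deriv_scaledTruncation_of_gt (hδ t ht.1) h, one_mul]
  rw [← tendsto_nhds_unique hFlim hlim0]
  refine integral_congr_ae ?_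
  filter_upwards [ae_restrict_of_ae (ae_mem_regularSet hR0)] with x hx
  have h := contDunklLap_radial_comp_mul hR0 k (θ := fun s => s) contDiff_id hq2 r hx
  simp only [deriv_id'', deriv_const', one_mul, zero_mul, add_zero] at h
  rw [h, mul_assoc]

theorem eqOn_zero_of_isDunklHarmonic (hd : 1 ≤ d) {R : Finset (E d)} (hR0 : ∀ α ∈ R, α ≠ 0)
    {k : E d → ℝ} (hk : ∀ α ∈ R, 0 < k α) {r : ℝ} (hr : 0 < r) {u : E d → ℝ}
    (hu : ContinuousOn u (closure (Metric.ball (0 : E d) r)))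
    (hu0 : ∀ x ∈ Metric.sphere (0 : E d) r, u x = 0)
    (hharm : IsDunklHarmonic R k (Metric.ball 0 r) u) :
    Set.EqOn u 0 (closure (Metric.ball (0 : E d) r)) := by
  have hcl : closure (Metric.ball (0 : E d) r) = Metric.closedBall 0 r := closure_ball _ hr.ne'
  have hwc : Continuous (wk R k) := continuous_wk hk
  have hpoly : ∀ n, ∀ g ∈ polyDegLT d n,
      ∫ x in Metric.ball (0 : E d) r, u x * g x * wk R k x = 0 := by
    intro n g hg
    obtain ⟨q, hq, hqg⟩ := exists_dunklLap_radial_mul_eq hd hR0 hk hr hg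
    rw [← integral_mul_dunklLap_radial_mul_eq_zero hR0 hk hr hu hu0 hharm
      (contDiff_of_mem_polyDegLT hq)]
    refine integral_congr_ae ?_
    filter_upwards [ae_restrict_of_ae (ae_mem_regularSet hR0)] with x hx
    rw [hqg x hx]
  have hsq : IntegrableOn (fun x => u x * u x * wk R k x) (Metric.ball (0 : E d) r) :=
    ContinuousOn.integrableOn_ball_of_closure hr ((hu.mul hu).mul hwc.continuousOn)
  have habs : IntegrableOn (fun x => |u x| * wk R k x) (Metric.ball (0 : E d) r) :=
    ContinuousOn.integrableOn_ball_of_closure hr (hu.abs.mul hwc.continuousOn)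
  have hnonneg : ∀ x, 0 ≤ u x * u x * wk R k x := fun x =>
    mul_nonneg (mul_self_nonneg _) (wk_nonneg R k x)
  have hle : ∀ ε > 0, ∫ x in Metric.ball (0 : E d) r, u x * u x * wk R k x ≤
      ε * ∫ x in Metric.ball (0 : E d) r, |u x| * wk R k x := by
    intro ε hε
    obtain ⟨n, p, hp, hpu⟩ := exists_polyDegLT_near (isCompact_closedBall (0 : E d) r) (hcl ▸ hu) hε
    have hpint : IntegrableOn (fun x => u x * p x * wk R k x) (Metric.ball (0 : E d) r) :=
      ContinuousOn.integrableOn_ball_of_closure hr ((hu.mul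
        (contDiff_of_mem_polyDegLT hp (m := 0)).continuous.continuousOn).mul hwc.continuousOn)
    calc ∫ x in Metric.ball (0 : E d) r, u x * u x * wk R k x
        = ∫ x in Metric.ball (0 : E d) r, (u x * u x * wk R k x - u x * p x * wk R k x) := by
          rw [integral_sub hsq hpint, hpoly n p hp, sub_zero]
      _ ≤ ∫ x in Metric.ball (0 : E d) r, ε * (|u x| * wk R k x) := by
          refine setIntegral_mono_on (hsq.sub hpint) (habs.const_mul ε) measurableSet_ball
            fun x hx => ?_
          have h := hpu x (Metric.ball_subset_closedBall hx)
          rw [abs_sub_comm] at h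
          calc u x * u x * wk R k x - u x * p x * wk R k x
              = u x * (u x - p x) * wk R k x := by ring
            _ ≤ |u x| * ε * wk R k x := by
                refine mul_le_mul_of_nonneg_right ((le_abs_self _).trans ?_) (wk_nonneg R k x)
                rw [abs_mul]
                exact mul_le_mul_of_nonneg_left h.le (abs_nonneg _)
            _ = ε * (|u x| * wk R k x) := by ring
      _ = ε * ∫ x in Metric.ball (0 : E d) r, |u x| * wk R k x := integral_const_mul _ _
  have hzero : ∫ x in Metric.ball (0 : E d) r, u x * u x * wk R k x = 0 := by
    have hlim : Tendsto (fun ε => ε * ∫ x in Metric.ball (0 : E d) r, |u x| * wk R k x)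
        (𝓝[>] 0) (𝓝 0) := by
      refine Tendsto.mono_left ?_ nhdsWithin_le_nhds
      simpa using (continuous_mul_const
        (∫ x in Metric.ball (0 : E d) r, |u x| * wk R k x)).tendsto (0 : ℝ)
    refine le_antisymm (ge_of_tendsto hlim ?_) (integral_nonneg hnonneg)
    filter_upwards [self_mem_nhdsWithin] with ε hε using hle ε hε
  have hae : u =ᵐ[volume.restrict (Metric.ball (0 : E d) r)] 0 := by
    filter_upwards [(integral_eq_zero_iff_of_nonneg (μ := volume.restrict (Metric.ball 0 r))
      hnonneg hsq).1 hzero, ae_restrict_of_ae (ae_mem_regularSet hR0)] with x hx hreg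
    exact mul_self_eq_zero.1 ((mul_eq_zero.1 hx).resolve_right (wk_pos k hreg).ne')
  have hball := Measure.eqOn_open_of_ae_eq hae Metric.isOpen_ball (hu.mono subset_closure)
    continuousOn_const
  intro x hx
  rw [hcl, ← Metric.ball_union_sphere] at hx
  exact hx.elim (fun h => hball h) fun h => hu0 x h

theorem IsDunklHarmonic.sub {R : Finset (E d)} (hR0 : ∀ α ∈ R, α ≠ 0) {k : E d → ℝ}
    (hk : ∀ α ∈ R, 0 < k α) {r : ℝ} (hr : 0 < r) {u v : E d → ℝ}
    (hu : ContinuousOn u (closure (Metric.ball (0 : E d) r)))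
    (hv : ContinuousOn v (closure (Metric.ball (0 : E d) r)))
    (hu' : IsDunklHarmonic R k (Metric.ball 0 r) u)
    (hv' : IsDunklHarmonic R k (Metric.ball 0 r) v) :
    IsDunklHarmonic R k (Metric.ball 0 r) fun x => u x - v x := by
  intro ψ hψ hc hsupp
  have hψ2 : ContDiff ℝ 2 ψ := by exact_mod_cast contDiff_infty.1 hψ 2
  have h1 := hu' ψ hψ hc hsupp
  have h2 := hv' ψ hψ hc hsupp
  rw [setIntegral_dunklLap_eq hR0 k _ hψ2] at h1 h2 ⊢
  have hG : Continuous fun x => contDunklLap R k ψ x * wk R k x :=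
    (continuous_contDunklLap R k hψ2).mul (continuous_wk hk)
  have hui := ContinuousOn.integrableOn_ball_of_closure hr (hu.mul hG.continuousOn)
  have hvi := ContinuousOn.integrableOn_ball_of_closure hr (hv.mul hG.continuousOn)
  simp only [sub_mul]
  exact (integral_sub hui hvi).trans (by rw [← sub_self (0 : ℝ)]; exact congrArg₂ _ h1 h2)

end Uniqueness

/-- the Dirichlet problem for Δ_k on a ball: existence and uniqueness of a
nonnegative continuous extension of boundary data which is Δ_k-harmonic in the ball. -/
theorem dunkl_dirichlet_problem
    (d : ℕ) (hd : 1 ≤ d)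
    (R : Finset (E d)) (hR0 : ∀ α ∈ R, α ≠ 0)
    (hRline : ∀ α ∈ R, (R : Set (E d)) ∩ {x | ∃ c : ℝ, x = c • α} = {α, -α})
    (hRrefl : ∀ α ∈ R, ∀ β ∈ R, dunklReflect α β ∈ R)
    (k : E d → ℝ) (hkpos : ∀ α ∈ R, 0 < k α)
    (hkinv : ∀ α ∈ R, ∀ β ∈ R, k (dunklReflect α β) = k β)
    (hm : 2 < (d : ℝ) + ∑ α ∈ R, k α)
    (r : ℝ) (hr : 0 < r)
    (f : E d → ℝ) (hf : ContinuousOn f (frontier (Metric.ball (0 : E d) r)))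
    (hf0 : ∀ x ∈ frontier (Metric.ball (0 : E d) r), 0 ≤ f x) :
    (∃ h : E d → ℝ,
        ContinuousOn h (closure (Metric.ball (0 : E d) r)) ∧
        (∀ x ∈ closure (Metric.ball (0 : E d) r), 0 ≤ h x) ∧
        (∀ x ∈ frontier (Metric.ball (0 : E d) r), h x = f x) ∧
        IsDunklHarmonic R k (Metric.ball 0 r) h) ∧
      (∀ h₁ h₂ : E d → ℝ,
        (ContinuousOn h₁ (closure (Metric.ball (0 : E d) r)) ∧
          (∀ x ∈ closure (Metric.ball (0 : E d) r), 0 ≤ h₁ x) ∧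
          (∀ x ∈ frontier (Metric.ball (0 : E d) r), h₁ x = f x) ∧
          IsDunklHarmonic R k (Metric.ball 0 r) h₁) →
        (ContinuousOn h₂ (closure (Metric.ball (0 : E d) r)) ∧
          (∀ x ∈ closure (Metric.ball (0 : E d) r), 0 ≤ h₂ x) ∧
          (∀ x ∈ frontier (Metric.ball (0 : E d) r), h₂ x = f x) ∧
          IsDunklHarmonic R k (Metric.ball 0 r) h₂) →
        Set.EqOn h₁ h₂ (closure (Metric.ball (0 : E d) r))) := by
  rw [frontier_ball _ hr.ne'] at hf hf0 ⊢
  refine ⟨exists_dunkl_dirichlet_solution hd hR0 hRrefl hkpos hkinv hr hf hf0, ?_⟩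
  rintro h₁ h₂ ⟨hc₁, -, hb₁, hh₁⟩ ⟨hc₂, -, hb₂, hh₂⟩ x hx
  exact sub_eq_zero.1 (eqOn_zero_of_isDunklHarmonic hd hR0 hkpos hr (hc₁.sub hc₂)
    (fun y hy => sub_eq_zero.2 ((hb₁ y hy).trans (hb₂ y hy).symm))
    (IsDunklHarmonic.sub hR0 hkpos hr hc₁ hc₂ hh₁ hh₂) hx)
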